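/- Let H be a cocommutative weak Hopf algebra over a commutative ring k and (φ_A, σ) a crossed system for H over A. Then A ↪ A×_σH (via the algebra map i_{A×_σH} = p_{A⊗H}∘(A⊗η_H), whose image is the coinvariant subalgebra) is an H-cleft extension: the map f = p_{A⊗H}∘(η_A⊗H): H → A×_σH is a convolution invertible total integral, with convolution inverse f^{-1} = p_{A⊗H}∘(σ^{-1}⊗H)∘(H⊗c_{H,H})∘((δ_H∘λ_H)⊗H)∘δ_H, and f∧f^{-1} takes values in the coinvariant subalgebra of A×_σH. -/

import Mathlib

open TensorProduct

noncomputable section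

namespace WHA

variable (k : Type) [CommRing k]

/-- Generalized convolution product of two linear maps from a "coalgebra"
(given by a comultiplication `δC`) to a module `P` with a product `m`. -/
def convG {C P : Type} [AddCommGroup C] [Module k C] [AddCommGroup P] [Module k P]
    (δC : C →ₗ[k] C ⊗[k] C) (m : P ⊗[k] P →ₗ[k] P) (f g : C →ₗ[k] P) : C →ₗ[k] P :=
  m ∘ₗ TensorProduct.map f g ∘ₗ δC

/-- Convolution product of two linear maps from a "coalgebra" to an algebra. -/
def conv {C A : Type} [AddCommGroup C] [Module k C] [Ring A] [Algebra k A]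
    (δC : C →ₗ[k] C ⊗[k] C) (f g : C →ₗ[k] A) : C →ₗ[k] A :=
  convG k δC (LinearMap.mul' k A) f g

variable (H : Type) [Ring H] [Algebra k H]

/-- The structure maps (comultiplication, counit, antipode) of a prospective
weak Hopf algebra on the `k`-algebra `H`. -/
structure HopfData where
  δ : H →ₗ[k] H ⊗[k] H
  ε : H →ₗ[k] k
  lam : H →ₗ[k] H

variable {k H}

/-- The target map `Π^L_H = ((ε∘μ)⊗H)∘(H⊗c)∘((δ∘η)⊗H)`. -/
def PiL (W : HopfData k H) : H →ₗ[k] H :=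
  (TensorProduct.rid k H).toLinearMap
    ∘ₗ LinearMap.lTensor H (W.ε ∘ₗ LinearMap.mul' k H)
    ∘ₗ (TensorProduct.assoc k H H H).toLinearMap
    ∘ₗ LinearMap.rTensor H (TensorProduct.comm k H H).toLinearMap
    ∘ₗ TensorProduct.mk k (H ⊗[k] H) H (W.δ 1)

/-- The source map `Π^R_H = (H⊗(ε∘μ))∘(c⊗H)∘(H⊗(δ∘η))`. -/
def PiR (W : HopfData k H) : H →ₗ[k] H :=
  (TensorProduct.lid k H).toLinearMap
    ∘ₗ LinearMap.rTensor H (W.ε ∘ₗ LinearMap.mul' k H)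
    ∘ₗ (TensorProduct.assoc k H H H).symm.toLinearMap
    ∘ₗ LinearMap.lTensor H (TensorProduct.comm k H H).toLinearMap
    ∘ₗ (TensorProduct.mk k H (H ⊗[k] H)).flip (W.δ 1)

/-- `H` together with the data `W` is a weak Hopf algebra. -/
structure IsWeakHopf (W : HopfData k H) : Prop where
  coassoc : ∀ h : H,
    (TensorProduct.assoc k H H H) ((LinearMap.rTensor H W.δ) (W.δ h)) =
      (LinearMap.lTensor H W.δ) (W.δ h)
  counit_left : ∀ h : H, (TensorProduct.lid k H) ((LinearMap.rTensor H W.ε) (W.δ h)) = h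
  counit_right : ∀ h : H, (TensorProduct.rid k H) ((LinearMap.lTensor H W.ε) (W.δ h)) = h
  a1 : ∀ x y : H, W.δ (x * y) = W.δ x * W.δ y
  a2 : ∀ x y z : H, W.ε (x * y * z) =
    LinearMap.mul' k k ((TensorProduct.map (W.ε ∘ₗ LinearMap.mulLeft k x)
      (W.ε ∘ₗ LinearMap.mulRight k z)) (W.δ y))
  a2' : ∀ x y z : H, W.ε (x * y * z) =
    LinearMap.mul' k k ((TensorProduct.map (W.ε ∘ₗ LinearMap.mulLeft k x)
      (W.ε ∘ₗ LinearMap.mulRight k z)) ((TensorProduct.comm k H H) (W.δ y)))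
  a3 : (TensorProduct.assoc k H H H) ((LinearMap.rTensor H W.δ) (W.δ 1)) =
    (TensorProduct.map LinearMap.id
        (Algebra.TensorProduct.includeLeft : H →ₐ[k] H ⊗[k] H).toLinearMap) (W.δ 1) *
      (Algebra.TensorProduct.includeRight : (H ⊗[k] H) →ₐ[k] H ⊗[k] (H ⊗[k] H)).toLinearMap
        (W.δ 1)
  a3' : (TensorProduct.assoc k H H H) ((LinearMap.rTensor H W.δ) (W.δ 1)) =
    (Algebra.TensorProduct.includeRight : (H ⊗[k] H) →ₐ[k] H ⊗[k] (H ⊗[k] H)).toLinearMap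
        (W.δ 1) *
      (TensorProduct.map LinearMap.id
        (Algebra.TensorProduct.includeLeft : H →ₐ[k] H ⊗[k] H).toLinearMap) (W.δ 1)
  a4_left : ∀ h : H,
    LinearMap.mul' k H ((TensorProduct.map LinearMap.id W.lam) (W.δ h)) = PiL W h
  a4_right : ∀ h : H,
    LinearMap.mul' k H ((TensorProduct.map W.lam LinearMap.id) (W.δ h)) = PiR W h
  a4_mid : conv k W.δ (conv k W.δ W.lam LinearMap.id) W.lam = W.lam

/-- `H` is cocommutative. -/
def Cocomm (W : HopfData k H) : Prop :=
  ∀ h : H, (TensorProduct.comm k H H) (W.δ h) = W.δ h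

section ComodAlg

variable {A : Type} [Ring A] [Algebra k A]

/-- The map `ζ_A = (μ_A⊗H)∘(A⊗c_{H,A})∘((ρ_A∘η_A)⊗A)`; in the tensor product
algebra `A ⊗ H` it is given by `a ↦ ρ(1) * (a ⊗ 1)`. -/
def zeta (ρ : A →ₗ[k] A ⊗[k] H) (a : A) : A ⊗[k] H :=
  ρ 1 * (a ⊗ₜ[k] (1 : H))

/-- `a` is a coinvariant element, i.e. belongs to `A_H`. -/
def IsCoinv (ρ : A →ₗ[k] A ⊗[k] H) (a : A) : Prop :=
  ρ a = zeta ρ a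

/-- `(A, ρ)` is a right `H`-comodule algebra. -/
structure IsComodAlg (W : HopfData k H) (ρ : A →ₗ[k] A ⊗[k] H) : Prop where
  coassoc : ∀ a : A, (TensorProduct.assoc k A H H) ((LinearMap.rTensor H ρ) (ρ a)) =
    (LinearMap.lTensor A W.δ) (ρ a)
  counit : ∀ a : A, (TensorProduct.rid k A) ((LinearMap.lTensor A W.ε) (ρ a)) = a
  mul_compat : ∀ a b : A, ρ (a * b) = ρ a * ρ b
  unit_coinv : (LinearMap.lTensor A (PiL W)) (ρ 1) = ρ 1

end ComodAlg

/-- For `t = Σ x ⊗ y : B ⊗ H`, the map `h ↦ Σ ε(h*y) • x`.  For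
`t = ρ(1)` this is the map `e_A = (A⊗ε)∘Γ∘(H⊗η)`. -/
def eGen (W : HopfData k H) {B : Type} [AddCommGroup B] [Module k B]
    (t : B ⊗[k] H) : H →ₗ[k] B :=
  (TensorProduct.lid k B).toLinearMap
    ∘ₗ LinearMap.rTensor B (W.ε ∘ₗ LinearMap.mul' k H)
    ∘ₗ (TensorProduct.assoc k H H B).symm.toLinearMap
    ∘ₗ LinearMap.lTensor H (TensorProduct.comm k B H).toLinearMap
    ∘ₗ (TensorProduct.mk k H (B ⊗[k] H)).flip t

/-- For `t = Σ x ⊗ y : B ⊗ H`, the map `h ↦ Σ ε(y*h) • x`.  For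
`t = ρ(1)` this is the map `(A⊗(ε∘μ))∘((ρ∘η)⊗H)`. -/
def dGen (W : HopfData k H) {B : Type} [AddCommGroup B] [Module k B]
    (t : B ⊗[k] H) : H →ₗ[k] B :=
  (TensorProduct.rid k B).toLinearMap
    ∘ₗ LinearMap.lTensor B (W.ε ∘ₗ LinearMap.mul' k H)
    ∘ₗ (TensorProduct.assoc k B H H).toLinearMap
    ∘ₗ TensorProduct.mk k (B ⊗[k] H) H t

section ComodAlg2

variable {A : Type} [Ring A] [Algebra k A]

/-- The entwining map `Γ_A^H = (A⊗μ_H)∘(c_{H,A}⊗H)∘(H⊗ρ_A)`. -/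
def Γmap (ρ : A →ₗ[k] A ⊗[k] H) : H ⊗[k] A →ₗ[k] A ⊗[k] H :=
  LinearMap.lTensor A (LinearMap.mul' k H)
    ∘ₗ (TensorProduct.assoc k A H H).toLinearMap
    ∘ₗ LinearMap.rTensor H (TensorProduct.comm k H A).toLinearMap
    ∘ₗ (TensorProduct.assoc k H A H).symm.toLinearMap
    ∘ₗ LinearMap.lTensor H ρ

/-- `f : H → A` is an integral, i.e. a morphism of right `H`-comodules. -/
def IsIntegral (W : HopfData k H) (ρ : A →ₗ[k] A ⊗[k] H) (f : H →ₗ[k] A) : Prop :=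
  ∀ h : H, ρ (f h) = (LinearMap.rTensor H f) (W.δ h)

/-- `finv` is the convolution inverse of the integral `f` (conditions (c1)-(c3)). -/
def IsConvInv (W : HopfData k H) (ρ : A →ₗ[k] A ⊗[k] H) (f finv : H →ₗ[k] A) : Prop :=
  conv k W.δ finv f = eGen W (ρ 1) ∧
  conv k W.δ f finv = dGen W (ρ 1) ∧
  conv k W.δ (conv k W.δ finv f) finv = finv

/-- `f` is a cleaving morphism (with convolution inverse `finv`) for the extension
`A_H ↪ A`, i.e. a convolution invertible integral such that `f ∧ f⁻¹` takes
values in the coinvariants. -/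
def IsCleaving (W : HopfData k H) (ρ : A →ₗ[k] A ⊗[k] H) (f finv : H →ₗ[k] A) : Prop :=
  IsIntegral W ρ f ∧ IsConvInv W ρ f finv ∧
    ∀ h : H, IsCoinv ρ (conv k W.δ f finv h)

end ComodAlg2

section ModAlg

variable {B : Type} [Ring B] [Algebra k B]

/-- `u₁ = φ ∘ (H ⊗ η_B)`. -/
def u1 (φ : H ⊗[k] B →ₗ[k] B) : H →ₗ[k] B :=
  φ ∘ₗ (TensorProduct.mk k H B).flip 1

/-- `u₂ = u₁ ∘ μ_H`. -/
def u2 (φ : H ⊗[k] B →ₗ[k] B) : H ⊗[k] H →ₗ[k] B :=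
  u1 φ ∘ₗ LinearMap.mul' k H

/-- `(B, φ)` is a weak left `H`-module algebra (conditions (d1)-(d4)). -/
def IsWeakModAlg (W : HopfData k H) (φ : H ⊗[k] B →ₗ[k] B) : Prop :=
  (∀ b : B, φ ((1 : H) ⊗ₜ[k] b) = b) ∧
  (∀ (h : H) (b c : B), φ (h ⊗ₜ[k] (b * c)) =
    LinearMap.mul' k B ((TensorProduct.map (φ ∘ₗ (TensorProduct.mk k H B).flip b)
      (φ ∘ₗ (TensorProduct.mk k H B).flip c)) (W.δ h))) ∧
  (∀ g h : H, φ ((g * h) ⊗ₜ[k] (1 : B)) = φ (g ⊗ₜ[k] φ (h ⊗ₜ[k] (1 : B)))) ∧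
  (∀ (h : H) (b : B), φ (PiL W h ⊗ₜ[k] b) = φ (h ⊗ₜ[k] (1 : B)) * b)

/-- `(B, φ)` is a left `H`-module algebra. -/
def IsModAlg (W : HopfData k H) (φ : H ⊗[k] B →ₗ[k] B) : Prop :=
  IsWeakModAlg W φ ∧
    ∀ (g h : H) (b : B), φ ((g * h) ⊗ₜ[k] b) = φ (g ⊗ₜ[k] φ (h ⊗ₜ[k] b))

/-- `(h, hinv)` is a pair of mutually convolution inverse elements in
`Reg_{φ}(H,B)`. -/
def IsRegPair (W : HopfData k H) (φ : H ⊗[k] B →ₗ[k] B) (h hinv : H →ₗ[k] B) : Prop :=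
  conv k W.δ h hinv = u1 φ ∧ conv k W.δ hinv h = u1 φ ∧
  conv k W.δ (conv k W.δ h hinv) h = h ∧
  conv k W.δ (conv k W.δ hinv h) hinv = hinv

end ModAlg

/-- The comultiplication of the tensor product coalgebra `H ⊗ H`. -/
def δ2 (W : HopfData k H) : H ⊗[k] H →ₗ[k] (H ⊗[k] H) ⊗[k] (H ⊗[k] H) :=
  (TensorProduct.tensorTensorTensorComm k H H H H).toLinearMap
    ∘ₗ TensorProduct.map W.δ W.δ

/-- The comultiplication of the tensor product coalgebra `H ⊗ (H ⊗ H)`. -/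
def δ3 (W : HopfData k H) :
    H ⊗[k] (H ⊗[k] H) →ₗ[k] (H ⊗[k] (H ⊗[k] H)) ⊗[k] (H ⊗[k] (H ⊗[k] H)) :=
  (TensorProduct.tensorTensorTensorComm k H H (H ⊗[k] H) (H ⊗[k] H)).toLinearMap
    ∘ₗ TensorProduct.map W.δ (δ2 W)

section ModAlg2

variable {B : Type} [Ring B] [Algebra k B]

/-- `(σ, σinv)` is a pair of mutually convolution inverse elements in
`Reg_{φ}(H⊗H,B)`. -/
def IsRegPair2 (W : HopfData k H) (φ : H ⊗[k] B →ₗ[k] B)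
    (σ σinv : H ⊗[k] H →ₗ[k] B) : Prop :=
  conv k (δ2 W) σ σinv = u2 φ ∧ conv k (δ2 W) σinv σ = u2 φ ∧
  conv k (δ2 W) (conv k (δ2 W) σ σinv) σ = σ ∧
  conv k (δ2 W) (conv k (δ2 W) σinv σ) σinv = σinv

/-- Condition (g1) (the twisted condition). -/
def CrossedG1 (W : HopfData k H) (φ : H ⊗[k] B →ₗ[k] B) (σ : H ⊗[k] H →ₗ[k] B) : Prop :=
  ∀ (x y : H) (b : B),
    LinearMap.mul' k B ((TensorProduct.map σ
        ((φ ∘ₗ (TensorProduct.mk k H B).flip b) ∘ₗ LinearMap.mul' k H))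
      (δ2 W (x ⊗ₜ[k] y))) =
    LinearMap.mul' k B ((TensorProduct.map
        (φ ∘ₗ LinearMap.lTensor H (φ ∘ₗ (TensorProduct.mk k H B).flip b)) σ)
      (δ2 W (x ⊗ₜ[k] y)))

/-- Condition (g2) (the cocycle condition). -/
def CrossedG2 (W : HopfData k H) (φ : H ⊗[k] B →ₗ[k] B) (σ : H ⊗[k] H →ₗ[k] B) : Prop :=
  conv k (δ3 W) (φ ∘ₗ LinearMap.lTensor H σ)
      (σ ∘ₗ LinearMap.lTensor H (LinearMap.mul' k H)) =
  conv k (δ3 W)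
      ((TensorProduct.rid k B).toLinearMap ∘ₗ TensorProduct.map σ W.ε
        ∘ₗ (TensorProduct.assoc k H H H).symm.toLinearMap)
      (σ ∘ₗ LinearMap.rTensor H (LinearMap.mul' k H)
        ∘ₗ (TensorProduct.assoc k H H H).symm.toLinearMap)

/-- Condition (g3) (the normal condition). -/
def CrossedG3 (W : HopfData k H) (φ : H ⊗[k] B →ₗ[k] B) (σ : H ⊗[k] H →ₗ[k] B) : Prop :=
  ∀ h : H, σ (h ⊗ₜ[k] (1 : H)) = u1 φ h ∧ σ ((1 : H) ⊗ₜ[k] h) = u1 φ h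

/-- `(φ, σ)` is a crossed system for `H` over `B`, with `σinv` the convolution
inverse of `σ`. -/
def IsCrossedSystem (W : HopfData k H) (φ : H ⊗[k] B →ₗ[k] B)
    (σ σinv : H ⊗[k] H →ₗ[k] B) : Prop :=
  IsWeakModAlg W φ ∧ IsRegPair2 W φ σ σinv ∧
    CrossedG1 W φ σ ∧ CrossedG2 W φ σ ∧ CrossedG3 W φ σ

/-- The condition that `h` conjugates the weak action `ϕ` into `φ`. -/
def FisEq (W : HopfData k H) (φ ϕ : H ⊗[k] B →ₗ[k] B) (h hinv : H →ₗ[k] B) : Prop :=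
  ∀ (g : H) (b : B), φ (g ⊗ₜ[k] b) =
    (LinearMap.mul' k B ∘ₗ LinearMap.rTensor B (LinearMap.mul' k B))
      ((TensorProduct.map (TensorProduct.map h (ϕ ∘ₗ (TensorProduct.mk k H B).flip b)) hinv)
        ((LinearMap.rTensor H W.δ) (W.δ g)))

/-- The condition that `h` transforms the cocycle `τ` into `σ`. -/
def SigmasEq (W : HopfData k H) (ϕ : H ⊗[k] B →ₗ[k] B)
    (σ τ : H ⊗[k] H →ₗ[k] B) (h hinv : H →ₗ[k] B) : Prop :=
  σ = conv k (δ2 W)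
    (LinearMap.mul' k B ∘ₗ TensorProduct.map h ϕ
      ∘ₗ (TensorProduct.assoc k H H B).toLinearMap ∘ₗ TensorProduct.map W.δ h)
    (conv k (δ2 W) τ (hinv ∘ₗ LinearMap.mul' k H))

/-- `h` (with convolution inverse `hinv`) realizes an equivalence between the
crossed systems `(φ, σ)` and `(ϕ, τ)`. -/
def RealizesEquiv (W : HopfData k H) (φ ϕ : H ⊗[k] B →ₗ[k] B)
    (σ τ : H ⊗[k] H →ₗ[k] B) (h hinv : H →ₗ[k] B) : Prop :=
  IsRegPair W φ h hinv ∧ IsRegPair W ϕ h hinv ∧ h 1 = 1 ∧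
    FisEq W φ ϕ h hinv ∧ SigmasEq W ϕ σ τ h hinv

/-- The crossed systems `(φ, σ)` and `(ϕ, τ)` are equivalent. -/
def CrossedEquiv (W : HopfData k H) (φ ϕ : H ⊗[k] B →ₗ[k] B)
    (σ τ : H ⊗[k] H →ₗ[k] B) : Prop :=
  u1 φ = u1 ϕ ∧ ∃ h hinv : H →ₗ[k] B, RealizesEquiv W φ ϕ σ τ h hinv

/-- The map `ψ_H^B = (φ⊗H)∘(H⊗c_{H,B})∘(δ_H⊗B)`. -/
def ψmap (W : HopfData k H) (φ : H ⊗[k] B →ₗ[k] B) : H ⊗[k] B →ₗ[k] B ⊗[k] H :=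
  LinearMap.rTensor H φ
    ∘ₗ (TensorProduct.assoc k H B H).symm.toLinearMap
    ∘ₗ LinearMap.lTensor H (TensorProduct.comm k H B).toLinearMap
    ∘ₗ (TensorProduct.assoc k H H B).toLinearMap
    ∘ₗ LinearMap.rTensor B W.δ

/-- The map `σ_H^B = (σ⊗μ_H)∘δ_{H⊗H}`. -/
def σHA (W : HopfData k H) (σ : H ⊗[k] H →ₗ[k] B) : H ⊗[k] H →ₗ[k] B ⊗[k] H :=
  TensorProduct.map σ (LinearMap.mul' k H) ∘ₗ δ2 W

/-- The idempotent `∇_{B⊗H} = (μ_B⊗H)∘(B⊗ψ_H^B)∘(B⊗H⊗η_B)`. -/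
def nabla (W : HopfData k H) (φ : H ⊗[k] B →ₗ[k] B) : B ⊗[k] H →ₗ[k] B ⊗[k] H :=
  LinearMap.rTensor H (LinearMap.mul' k B)
    ∘ₗ (TensorProduct.assoc k B B H).symm.toLinearMap
    ∘ₗ LinearMap.lTensor B (ψmap W φ)
    ∘ₗ LinearMap.lTensor B ((TensorProduct.mk k H B).flip 1)

/-- The product `(μ_B⊗H)∘(μ_B⊗σ_H^B)∘(B⊗ψ_H^B⊗H)` on `B ⊗ H`. -/
def crossmulAmb (W : HopfData k H) (φ : H ⊗[k] B →ₗ[k] B) (σ : H ⊗[k] H →ₗ[k] B) :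
    (B ⊗[k] H) ⊗[k] (B ⊗[k] H) →ₗ[k] B ⊗[k] H :=
  LinearMap.rTensor H (LinearMap.mul' k B)
    ∘ₗ (TensorProduct.assoc k B B H).symm.toLinearMap
    ∘ₗ LinearMap.lTensor B (LinearMap.rTensor H (LinearMap.mul' k B))
    ∘ₗ LinearMap.lTensor B ((TensorProduct.assoc k B B H).symm.toLinearMap)
    ∘ₗ LinearMap.lTensor B (LinearMap.lTensor B (σHA W σ))
    ∘ₗ LinearMap.lTensor B ((TensorProduct.assoc k B H H).toLinearMap)
    ∘ₗ LinearMap.lTensor B (LinearMap.rTensor H (ψmap W φ))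
    ∘ₗ LinearMap.lTensor B ((TensorProduct.assoc k H B H).symm.toLinearMap)
    ∘ₗ (TensorProduct.assoc k B H (B ⊗[k] H)).toLinearMap

end ModAlg2

section CrossProd

variable {B : Type} [Ring B] [Algebra k B]
variable {P : Type} [AddCommGroup P] [Module k P]

/-- The product of the weak crossed product `B ×_σ H`, through a splitting
`(P, p, ι)` of the idempotent `∇_{B⊗H}`. -/
def crossMul (W : HopfData k H) (φ : H ⊗[k] B →ₗ[k] B) (σ : H ⊗[k] H →ₗ[k] B)
    (p : B ⊗[k] H →ₗ[k] P) (ι : P →ₗ[k] B ⊗[k] H) : P ⊗[k] P →ₗ[k] P :=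
  p ∘ₗ crossmulAmb W φ σ ∘ₗ TensorProduct.map ι ι

/-- The unit of the weak crossed product `B ×_σ H`. -/
def crossUnit (W : HopfData k H) (φ : H ⊗[k] B →ₗ[k] B)
    (p : B ⊗[k] H →ₗ[k] P) : P :=
  p (nabla W φ ((1 : B) ⊗ₜ[k] (1 : H)))

/-- The coaction `ρ_{B×H} = (p⊗H)∘(B⊗δ_H)∘ι` of the weak crossed product. -/
def crossCoact (W : HopfData k H)
    (p : B ⊗[k] H →ₗ[k] P) (ι : P →ₗ[k] B ⊗[k] H) : P →ₗ[k] P ⊗[k] H :=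
  LinearMap.rTensor H p ∘ₗ (TensorProduct.assoc k B H H).symm.toLinearMap
    ∘ₗ LinearMap.lTensor B W.δ ∘ₗ ι

/-- The inclusion `i_{B×H} = p∘(B⊗η_H) : B → B × H`. -/
def crossInc (p : B ⊗[k] H →ₗ[k] P) : B →ₗ[k] P :=
  p ∘ₗ (TensorProduct.mk k B H).flip 1

/-- The analogue of `ζ` for an abstract module `P` with product `m`:
`ζ(x) = t · (x ⊗ 1)` where `t` plays the role of `ρ(1)`. -/
def zetaGen (m : P ⊗[k] P →ₗ[k] P) (t : P ⊗[k] H) (x : P) : P ⊗[k] H :=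
  (TensorProduct.map m (LinearMap.mul' k H))
    ((TensorProduct.tensorTensorTensorComm k P H P H) (t ⊗ₜ[k] (x ⊗ₜ[k] (1 : H))))

end CrossProd

section Induced

variable {D P : Type} [AddCommGroup D] [Module k D] [AddCommGroup P] [Module k P]

/-- The map `(P⊗P)⊗P → P`, `(x⊗y)⊗z ↦ x·(z·y)`. -/
def mulSwizG (m : P ⊗[k] P →ₗ[k] P) : (P ⊗[k] P) ⊗[k] P →ₗ[k] P :=
  m ∘ₗ LinearMap.lTensor P (m ∘ₗ (TensorProduct.comm k P P).toLinearMap)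
    ∘ₗ (TensorProduct.assoc k P P P).toLinearMap

/-- The ambient weak action `μ∘(P⊗(μ∘c))∘(((f⊗f⁻¹)∘δ_H)⊗j) : H ⊗ D → P`
induced by a cleaving morphism `f`. -/
def phiAmb (W : HopfData k H) (m : P ⊗[k] P →ₗ[k] P) (f finv : H →ₗ[k] P)
    (j : D →ₗ[k] P) : H ⊗[k] D →ₗ[k] P :=
  mulSwizG m ∘ₗ TensorProduct.map ((TensorProduct.map f finv) ∘ₗ W.δ) j

/-- The ambient cocycle `(μ∘(f⊗f)) ∧ (f⁻¹∘μ_H) : H ⊗ H → P` induced by a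
cleaving morphism `f`. -/
def sigmaAmb (W : HopfData k H) (m : P ⊗[k] P →ₗ[k] P) (f finv : H →ₗ[k] P) :
    H ⊗[k] H →ₗ[k] P :=
  convG k (δ2 W) m (m ∘ₗ TensorProduct.map f f) (finv ∘ₗ LinearMap.mul' k H)

end Induced

section Pres

variable {A D : Type} [Ring A] [Algebra k A] [Ring D] [Algebra k D]

/-- `j : D → A` presents `D` as the subalgebra of coinvariants of `A`. -/
def IsCoinvPres (ρ : A →ₗ[k] A ⊗[k] H) (j : D →ₐ[k] A) : Prop :=
  Function.Injective j ∧ ∀ a : A, IsCoinv ρ a ↔ a ∈ Set.range j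

end Pres

section Pairing

open Coalgebra

variable {k : Type} [CommRing k] {C : Type} [AddCommGroup C] [Module k C] [Coalgebra k C]
variable {X Y Z T X' Y' : Type}
  [AddCommGroup X] [Module k X] [AddCommGroup Y] [Module k Y] [AddCommGroup Z] [Module k Z]
  [AddCommGroup T] [Module k T] [AddCommGroup X'] [Module k X'] [AddCommGroup Y'] [Module k Y']

/-- The pairing `(a ⊗ b) ∘ δ` of two linear maps out of a coalgebra. -/
def pair (a : C →ₗ[k] X) (b : C →ₗ[k] Y) : C →ₗ[k] X ⊗[k] Y :=
  TensorProduct.map a b ∘ₗ comul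

theorem map_pair (f : X →ₗ[k] X') (g : Y →ₗ[k] Y') (a : C →ₗ[k] X) (b : C →ₗ[k] Y) (c : C) :
    TensorProduct.map f g (pair a b c) = pair (f ∘ₗ a) (g ∘ₗ b) c := by
  simp [pair, TensorProduct.map_comp]

theorem rTensor_pair (f : X →ₗ[k] X') (a : C →ₗ[k] X) (b : C →ₗ[k] Y) (c : C) :
    LinearMap.rTensor Y f (pair a b c) = pair (f ∘ₗ a) b c :=
  map_pair f LinearMap.id a b c

theorem lTensor_pair (g : Y →ₗ[k] Y') (a : C →ₗ[k] X) (b : C →ₗ[k] Y) (c : C) :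
    LinearMap.lTensor X g (pair a b c) = pair a (g ∘ₗ b) c :=
  map_pair LinearMap.id g a b c

theorem assoc_pair (a : C →ₗ[k] X) (b : C →ₗ[k] Y) (d : C →ₗ[k] Z) (c : C) :
    TensorProduct.assoc k X Y Z (pair (pair a b) d c) = pair a (pair b d) c := by
  have h := congrArg (TensorProduct.map a (TensorProduct.map b d)) (coassoc_apply (R := k) c)
  rw [TensorProduct.map_map_assoc, LinearMap.rTensor, LinearMap.lTensor,
    ← LinearMap.comp_apply (TensorProduct.map _ _) (TensorProduct.map _ _),
    ← LinearMap.comp_apply (TensorProduct.map _ _) (TensorProduct.map _ _),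
    ← TensorProduct.map_comp, ← TensorProduct.map_comp] at h
  exact h

theorem assoc_symm_pair (a : C →ₗ[k] X) (b : C →ₗ[k] Y) (d : C →ₗ[k] Z) (c : C) :
    (TensorProduct.assoc k X Y Z).symm (pair a (pair b d) c) = pair (pair a b) d c := by
  rw [LinearEquiv.symm_apply_eq, assoc_pair]

theorem pair_unit_left (b : C →ₗ[k] Y) (c : C) (x : X) :
    pair (LinearMap.toSpanSingleton k X x ∘ₗ counit) b c = x ⊗ₜ[k] b c := by
  have h := congrArg (TensorProduct.map (LinearMap.toSpanSingleton k X x) b)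
    (rTensor_counit_comul (R := k) c)
  simpa [pair, LinearMap.rTensor, TensorProduct.map_map] using h

theorem rTensor_comp_pair (f : X →ₗ[k] X') (a : C →ₗ[k] X) (b : C →ₗ[k] Y) :
    LinearMap.rTensor Y f ∘ₗ pair a b = pair (f ∘ₗ a) b :=
  LinearMap.ext fun c => rTensor_pair f a b c

theorem lTensor_comp_pair (f : X →ₗ[k] X') (a : C →ₗ[k] Y) (b : C →ₗ[k] X) :
    LinearMap.lTensor Y f ∘ₗ pair a b = pair a (f ∘ₗ b) :=
  LinearMap.ext fun c => lTensor_pair f a b c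

theorem assoc_comp_pair (a : C →ₗ[k] X) (b : C →ₗ[k] Y) (d : C →ₗ[k] Z) :
    (TensorProduct.assoc k X Y Z).toLinearMap ∘ₗ pair (pair a b) d = pair a (pair b d) :=
  LinearMap.ext fun c => assoc_pair a b d c

theorem assoc_symm_comp_pair (a : C →ₗ[k] X) (b : C →ₗ[k] Y) (d : C →ₗ[k] Z) :
    (TensorProduct.assoc k X Y Z).symm.toLinearMap ∘ₗ pair a (pair b d) = pair (pair a b) d :=
  LinearMap.ext fun c => assoc_symm_pair a b d c

theorem rid_comp_pair_counit (a : C →ₗ[k] X) :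
    (TensorProduct.rid k X).toLinearMap ∘ₗ pair a (counit : C →ₗ[k] k) = a := by
  ext c
  have h := congrArg (TensorProduct.map a LinearMap.id) (lTensor_counit_comul (R := k) c)
  rw [LinearMap.lTensor, TensorProduct.map_map, LinearMap.comp_id, LinearMap.id_comp] at h
  simp [pair, h]

variable [IsCocomm k C]

theorem comm_pair (a : C →ₗ[k] X) (b : C →ₗ[k] Y) (c : C) :
    TensorProduct.comm k X Y (pair a b c) = pair b a c := by
  conv_rhs => rw [pair, LinearMap.comp_apply, ← comm_comul k c]
  rw [pair, LinearMap.comp_apply, TensorProduct.map_comm]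

theorem comm_comp_pair (a : C →ₗ[k] X) (b : C →ₗ[k] Y) :
    (TensorProduct.comm k X Y).toLinearMap ∘ₗ pair a b = pair b a :=
  LinearMap.ext fun c => comm_pair a b c

theorem tensorTensorTensorComm_pair (a : C →ₗ[k] X) (b : C →ₗ[k] Y) (d : C →ₗ[k] Z)
    (e : C →ₗ[k] T) (c : C) :
    TensorProduct.tensorTensorTensorComm k X Y Z T (pair (pair a b) (pair d e) c) =
      pair (pair a d) (pair b e) c := by
  have h : (TensorProduct.tensorTensorTensorComm k X Y Z T).toLinearMap =
      (TensorProduct.assoc k X Z (Y ⊗[k] T)).symm.toLinearMap ∘ₗ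
      LinearMap.lTensor X ((TensorProduct.assoc k Z Y T).toLinearMap ∘ₗ
        LinearMap.rTensor T (TensorProduct.comm k Y Z).toLinearMap ∘ₗ
        (TensorProduct.assoc k Y Z T).symm.toLinearMap) ∘ₗ
      (TensorProduct.assoc k X Y (Z ⊗[k] T)).toLinearMap := by
    ext x y z t; simp
  have h' : (TensorProduct.assoc k Z Y T).toLinearMap ∘ₗ
        LinearMap.rTensor T (TensorProduct.comm k Y Z).toLinearMap ∘ₗ
        (TensorProduct.assoc k Y Z T).symm.toLinearMap ∘ₗ pair b (pair d e) =
      pair d (pair b e) := by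
    ext c
    simp only [LinearMap.comp_apply, LinearEquiv.coe_coe, assoc_symm_pair, rTensor_pair]
    rw [comm_comp_pair, assoc_pair]
  rw [← LinearEquiv.coe_coe, h]
  simp only [LinearMap.comp_apply, LinearEquiv.coe_coe, assoc_pair, lTensor_pair]
  simp only [LinearMap.comp_assoc]
  rw [h', assoc_symm_pair]

end Pairing

section Points

open Coalgebra

variable {k : Type} [CommRing k] {C : Type} [AddCommGroup C] [Module k C] [Coalgebra k C]
variable {H A : Type} [Ring H] [Algebra k H] [Ring A] [Algebra k A]

theorem conv_comul_apply (a b : C →ₗ[k] A) (c : C) :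
    conv k comul a b c = LinearMap.mul' k A (pair a b c) := rfl

theorem conv_eq_comp_pair (a b : C →ₗ[k] A) :
    conv k comul a b = LinearMap.mul' k A ∘ₗ pair a b := rfl

theorem conv_assoc (a b d : C →ₗ[k] A) :
    conv k comul (conv k comul a b) d = conv k comul a (conv k comul b d) := by
  ext c
  have h : LinearMap.mul' k A ∘ₗ LinearMap.rTensor A (LinearMap.mul' k A) =
      LinearMap.mul' k A ∘ₗ LinearMap.lTensor A (LinearMap.mul' k A) ∘ₗ
      (TensorProduct.assoc k A A A).toLinearMap := by
    ext x y z; simp [mul_assoc]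
  have := LinearMap.congr_fun h (pair (pair a b) d c)
  simp only [LinearMap.comp_apply, LinearEquiv.coe_coe, assoc_pair, lTensor_pair,
    rTensor_pair] at this
  exact this

/-- The unit of the convolution algebra. -/
def convOne (k : Type) [CommRing k] (C : Type) [AddCommGroup C] [Module k C] [Coalgebra k C]
    (A : Type) [Ring A] [Algebra k A] : C →ₗ[k] A :=
  LinearMap.toSpanSingleton k A 1 ∘ₗ counit

theorem pair_convOne_left {Y : Type} [AddCommGroup Y] [Module k Y] (b : C →ₗ[k] Y) (c : C) :
    pair (convOne k C A) b c = 1 ⊗ₜ[k] b c :=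
  pair_unit_left b c 1

theorem convOne_conv (b : C →ₗ[k] A) : conv k comul (convOne k C A) b = b := by
  ext c
  simp [conv_comul_apply, pair_convOne_left]

theorem conv_comp {D : Type} [AddCommGroup D] [Module k D] {δD : D →ₗ[k] D ⊗[k] D}
    {q : C →ₗ[k] D} (hq : δD ∘ₗ q = pair q q) (f g : D →ₗ[k] A) :
    conv k δD f g ∘ₗ q = conv k comul (f ∘ₗ q) (g ∘ₗ q) := by
  ext c
  rw [LinearMap.comp_apply, conv, convG, LinearMap.comp_apply, LinearMap.comp_apply,
    ← LinearMap.comp_apply δD, hq, map_pair]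
  rfl

/-- A linear map `α : C → H` compatible with the comultiplications (but not necessarily with the
counits): a generalized group-like element. -/
def IsPoint (W : HopfData k H) (α : C →ₗ[k] H) : Prop :=
  W.δ ∘ₗ α = pair α α

variable {W : HopfData k H}

theorem δ_comp_conv (hW : IsWeakHopf W) (a b : C →ₗ[k] H) :
    W.δ ∘ₗ conv k comul a b = conv k comul (W.δ ∘ₗ a) (W.δ ∘ₗ b) := by
  have h : W.δ ∘ₗ LinearMap.mul' k H =
      LinearMap.mul' k (H ⊗[k] H) ∘ₗ TensorProduct.map W.δ W.δ := by
    ext x y; simp [hW.a1]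
  rw [conv_eq_comp_pair, ← LinearMap.comp_assoc, h]
  ext c
  simp [conv_comul_apply, map_pair]

variable [IsCocomm k C]

theorem δ2_pair {α β : C →ₗ[k] H} (hα : IsPoint W α) (hβ : IsPoint W β) :
    δ2 W ∘ₗ pair α β = pair (pair α β) (pair α β) := by
  ext c
  simp only [δ2, LinearMap.comp_apply, map_pair, LinearEquiv.coe_coe]
  rw [hα, hβ, tensorTensorTensorComm_pair]

theorem δ3_pair {α β γ : C →ₗ[k] H} (hα : IsPoint W α) (hβ : IsPoint W β) (hγ : IsPoint W γ) :
    δ3 W ∘ₗ pair α (pair β γ) =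
      pair (pair α (pair β γ)) (pair α (pair β γ)) := by
  ext c
  simp only [δ3, LinearMap.comp_apply, map_pair, LinearEquiv.coe_coe]
  rw [hα, δ2_pair hβ hγ, tensorTensorTensorComm_pair]

theorem mul_pair_pair (a b c d : C →ₗ[k] H) :
    conv k comul (pair a b) (pair c d) = pair (conv k comul a c) (conv k comul b d) := by
  ext x
  have h : LinearMap.mul' k (H ⊗[k] H) =
      TensorProduct.map (LinearMap.mul' k H) (LinearMap.mul' k H) ∘ₗ
        (TensorProduct.tensorTensorTensorComm k H H H H).toLinearMap := by
    ext; simp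
  rw [conv_comul_apply, h, LinearMap.comp_apply, LinearEquiv.coe_coe,
    tensorTensorTensorComm_pair, map_pair]
  rfl

theorem IsPoint.conv (hW : IsWeakHopf W) {α β : C →ₗ[k] H} (hα : IsPoint W α)
    (hβ : IsPoint W β) : IsPoint W (conv k comul α β) := by
  rw [IsPoint, δ_comp_conv hW, ← mul_pair_pair, hα, hβ]

end Points

section Base

variable {k : Type} [CommRing k] {H : Type} [Ring H] [Algebra k H] {W : HopfData k H}

section Gen

variable {B : Type} [AddCommGroup B] [Module k B]

theorem dGen_tmul (x : B) (y h : H) : dGen W (x ⊗ₜ[k] y) h = W.ε (y * h) • x := by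
  simp [dGen]

theorem dGen_add (t s : B ⊗[k] H) (h : H) : dGen W (t + s) h = dGen W t h + dGen W s h := by
  simp [dGen]

theorem dGen_zero (h : H) : dGen W (0 : B ⊗[k] H) h = 0 := by
  simp [dGen]

theorem eGen_tmul (x : B) (y h : H) : eGen W (x ⊗ₜ[k] y) h = W.ε (h * y) • x := by
  simp [eGen]

theorem eGen_add (t s : B ⊗[k] H) (h : H) : eGen W (t + s) h = eGen W t h + eGen W s h := by
  simp [eGen]

theorem eGen_zero (h : H) : eGen W (0 : B ⊗[k] H) h = 0 := by
  simp [eGen]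

theorem dGen_rTensor {D : Type} [AddCommGroup D] [Module k D] (f : D →ₗ[k] B) (t : D ⊗[k] H) :
    dGen W (LinearMap.rTensor H f t) = f ∘ₗ dGen W t := by
  ext h
  induction t using TensorProduct.induction_on with
  | zero => simp [dGen_zero]
  | tmul x y => simp [dGen_tmul]
  | add t s ht hs => simp_all [dGen_add]

theorem eGen_rTensor {D : Type} [AddCommGroup D] [Module k D] (f : D →ₗ[k] B) (t : D ⊗[k] H) :
    eGen W (LinearMap.rTensor H f t) = f ∘ₗ eGen W t := by
  ext h
  induction t using TensorProduct.induction_on with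
  | zero => simp [eGen_zero]
  | tmul x y => simp [eGen_tmul]
  | add t s ht hs => simp_all [eGen_add]

end Gen

theorem PiR_eq_eGen (W : HopfData k H) : PiR W = eGen W (W.δ 1) := rfl

theorem PiL_eq_dGen (hcc : Cocomm W) : PiL W = dGen W (W.δ 1) := by
  ext h
  rw [← hcc 1]
  simp only [PiL, LinearMap.comp_apply, LinearEquiv.coe_coe, TensorProduct.mk_apply]
  generalize W.δ 1 = t
  induction t using TensorProduct.induction_on with
  | zero => simp [dGen_zero]
  | tmul x y => simp [dGen_tmul]
  | add t s ht hs => simp_all [dGen_add, add_tmul]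

/-- Elements of the (common) base of a cocommutative weak Hopf algebra. -/
def IsBase (W : HopfData k H) (x : H) : Prop :=
  W.δ x = (x ⊗ₜ[k] (1 : H)) * W.δ 1 ∧ W.δ x = W.δ 1 * (x ⊗ₜ[k] (1 : H))

theorem isBase_contract (hW : IsWeakHopf W) (ξ : H →ₗ[k] k) :
    IsBase W (TensorProduct.lid k H (LinearMap.rTensor H ξ (W.δ 1))) := by
  have hδ : ∀ t : H ⊗[k] H, W.δ (TensorProduct.lid k H (LinearMap.rTensor H ξ t)) =
      TensorProduct.lid k (H ⊗[k] H) (LinearMap.rTensor (H ⊗[k] H) ξ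
        (LinearMap.lTensor H W.δ t)) := fun t => by
    induction t using TensorProduct.induction_on with
    | zero => simp
    | tmul x y => simp
    | add t s ht hs => simp only [map_add, ht, hs]
  rw [IsBase, hδ, ← hW.coassoc]
  constructor
  · rw [hW.a3]
    generalize W.δ 1 = s
    suffices ∀ t, TensorProduct.lid k (H ⊗[k] H) (LinearMap.rTensor (H ⊗[k] H) ξ
        (TensorProduct.map LinearMap.id
          (Algebra.TensorProduct.includeLeft : H →ₐ[k] H ⊗[k] H).toLinearMap t *
        (Algebra.TensorProduct.includeRight : (H ⊗[k] H) →ₐ[k] H ⊗[k] (H ⊗[k] H)).toLinearMap s)) =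
        (TensorProduct.lid k H (LinearMap.rTensor H ξ t) ⊗ₜ[k] (1 : H)) * s from this s
    intro t
    induction t using TensorProduct.induction_on with
    | zero => simp
    | tmul x y => simp [← smul_tmul']
    | add t s ht hs => simp only [map_add, add_mul, ht, hs, add_tmul]
  · rw [hW.a3']
    generalize W.δ 1 = s
    suffices ∀ t, TensorProduct.lid k (H ⊗[k] H) (LinearMap.rTensor (H ⊗[k] H) ξ
        ((Algebra.TensorProduct.includeRight : (H ⊗[k] H) →ₐ[k] H ⊗[k] (H ⊗[k] H)).toLinearMap s *
        TensorProduct.map LinearMap.id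
          (Algebra.TensorProduct.includeLeft : H →ₐ[k] H ⊗[k] H).toLinearMap t)) =
        s * (TensorProduct.lid k H (LinearMap.rTensor H ξ t) ⊗ₜ[k] (1 : H)) from this s
    intro t
    induction t using TensorProduct.induction_on with
    | zero => simp
    | tmul x y => simp [← smul_tmul']
    | add t s ht hs => simp only [map_add, mul_add, ht, hs, add_tmul]

theorem isBase_PiL (hW : IsWeakHopf W) (hcc : Cocomm W) (h : H) : IsBase W (PiL W h) := by
  convert isBase_contract hW (W.ε ∘ₗ LinearMap.mulRight k h) using 1
  rw [PiL_eq_dGen hcc]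
  conv_rhs => rw [← hcc 1]
  generalize W.δ 1 = t
  induction t using TensorProduct.induction_on with
  | zero => simp [dGen_zero]
  | tmul x y => simp [dGen_tmul]
  | add t s ht hs => simp only [dGen_add, map_add, ht, hs]

theorem isBase_PiR (hW : IsWeakHopf W) (hcc : Cocomm W) (h : H) : IsBase W (PiR W h) := by
  convert isBase_contract hW (W.ε ∘ₗ LinearMap.mulLeft k h) using 1
  rw [PiR_eq_eGen]
  conv_rhs => rw [← hcc 1]
  generalize W.δ 1 = t
  induction t using TensorProduct.induction_on with
  | zero => simp [eGen_zero]
  | tmul x y => simp [eGen_tmul]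
  | add t s ht hs => simp only [eGen_add, map_add, ht, hs]

theorem IsBase.PiL_eq (hW : IsWeakHopf W) (hcc : Cocomm W) {x : H} (hx : IsBase W x) :
    PiL W x = x := by
  have h : ∀ t : H ⊗[k] H, dGen W (TensorProduct.comm k H H t) x =
      TensorProduct.lid k H (LinearMap.rTensor H W.ε (t * (x ⊗ₜ[k] (1 : H)))) := fun t => by
    induction t using TensorProduct.induction_on with
    | zero => simp [dGen_zero]
    | tmul x y => simp [dGen_tmul]
    | add t s ht hs => simp only [add_mul, map_add, dGen_add, ht, hs]
  rw [PiL_eq_dGen hcc, ← hcc 1, h, ← hx.2, hW.counit_left]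

/-- Contraction of the middle leg of `H ⊗ (H ⊗ H)` by the counit. -/
def midCounit (W : HopfData k H) : H ⊗[k] (H ⊗[k] H) →ₗ[k] H ⊗[k] H :=
  LinearMap.lTensor H ((TensorProduct.lid k H).toLinearMap ∘ₗ LinearMap.rTensor H W.ε)

theorem midCounit_assoc (hW : IsWeakHopf W) (t : H ⊗[k] H) :
    midCounit W (TensorProduct.assoc k H H H (LinearMap.rTensor H W.δ t)) = t := by
  induction t using TensorProduct.induction_on with
  | zero => simp
  | tmul x y =>
    conv_rhs => rw [← hW.counit_right x]
    simp only [LinearMap.rTensor_tmul]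
    generalize W.δ x = s
    induction s using TensorProduct.induction_on with
    | zero => simp
    | tmul u v => simp [midCounit, smul_tmul']
    | add s r hs hr => simp only [map_add, add_tmul, hs, hr]
  | add t s ht hs => simp only [map_add, ht, hs]

theorem assoc_mul (s t : (H ⊗[k] H) ⊗[k] H) :
    TensorProduct.assoc k H H H (s * t) =
      TensorProduct.assoc k H H H s * TensorProduct.assoc k H H H t :=
  map_mul (Algebra.TensorProduct.assoc k k k H H H) s t

theorem rTensor_δ_mul_left (hW : IsWeakHopf W) (t : H ⊗[k] H) (h : H) :
    LinearMap.rTensor H W.δ (t * (h ⊗ₜ[k] (1 : H))) =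
      LinearMap.rTensor H W.δ t * (W.δ h ⊗ₜ[k] (1 : H)) := by
  induction t using TensorProduct.induction_on with
  | zero => simp
  | tmul x y => simp [hW.a1]
  | add t s ht hs => simp only [add_mul, map_add, ht, hs]

theorem rTensor_δ_mul_right (hW : IsWeakHopf W) (t : H ⊗[k] H) (h : H) :
    LinearMap.rTensor H W.δ ((h ⊗ₜ[k] (1 : H)) * t) =
      (W.δ h ⊗ₜ[k] (1 : H)) * LinearMap.rTensor H W.δ t := by
  induction t using TensorProduct.induction_on with
  | zero => simp
  | tmul x y => simp [hW.a1]
  | add t s ht hs => simp only [mul_add, map_add, ht, hs]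

theorem lTensor_PiL_δ (hW : IsWeakHopf W) (hcc : Cocomm W) (h : H) :
    LinearMap.lTensor H (PiL W) (W.δ h) = W.δ 1 * (h ⊗ₜ[k] (1 : H)) := by
  rw [← midCounit_assoc hW (W.δ 1 * _), rTensor_δ_mul_left hW, assoc_mul, hW.a3',
    PiL_eq_dGen hcc]
  have key : ∀ t s d : H ⊗[k] H, midCounit W
      ((Algebra.TensorProduct.includeRight : (H ⊗[k] H) →ₐ[k] H ⊗[k] (H ⊗[k] H)).toLinearMap t *
        TensorProduct.map LinearMap.id
          (Algebra.TensorProduct.includeLeft : H →ₐ[k] H ⊗[k] H).toLinearMap s *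
        TensorProduct.assoc k H H H (d ⊗ₜ[k] (1 : H))) =
      LinearMap.lTensor H (dGen W (TensorProduct.comm k H H t)) (s * d) := fun t s d => by
    induction d using TensorProduct.induction_on with
    | zero => simp
    | add d e hd he => simp only [add_tmul, map_add, mul_add, hd, he]
    | tmul u v =>
      induction s using TensorProduct.induction_on with
      | zero => simp
      | add d e hd he => simp only [map_add, mul_add, add_mul, hd, he]
      | tmul a b =>
        induction t using TensorProduct.induction_on with
        | zero => simp [dGen_zero]
        | tmul x y => simp [midCounit, dGen_tmul, mul_assoc]
        | add d e hd he =>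
          simp only [map_add, add_mul, hd, he]
          simp [dGen_add, tmul_add]
  rw [key, hcc, ← hW.a1, one_mul]

theorem lTensor_PiR_δ (hW : IsWeakHopf W) (hcc : Cocomm W) (h : H) :
    LinearMap.lTensor H (PiR W) (W.δ h) = (h ⊗ₜ[k] (1 : H)) * W.δ 1 := by
  rw [← midCounit_assoc hW (_ * W.δ 1), rTensor_δ_mul_right hW, assoc_mul, hW.a3,
    PiR_eq_eGen]
  have key : ∀ t s d : H ⊗[k] H, midCounit W
      (TensorProduct.assoc k H H H (d ⊗ₜ[k] (1 : H)) *
        (TensorProduct.map LinearMap.id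
          (Algebra.TensorProduct.includeLeft : H →ₐ[k] H ⊗[k] H).toLinearMap s *
        (Algebra.TensorProduct.includeRight : (H ⊗[k] H) →ₐ[k] H ⊗[k] (H ⊗[k] H)).toLinearMap t)) =
      LinearMap.lTensor H (eGen W (TensorProduct.comm k H H t)) (d * s) := fun t s d => by
    induction d using TensorProduct.induction_on with
    | zero => simp
    | add d e hd he => simp only [add_tmul, map_add, add_mul, hd, he]
    | tmul u v =>
      induction s using TensorProduct.induction_on with
      | zero => simp
      | add d e hd he => simp only [map_add, mul_add, add_mul, hd, he]
      | tmul a b =>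
        induction t using TensorProduct.induction_on with
        | zero => simp [eGen_zero]
        | tmul x y => simp [midCounit, eGen_tmul, mul_assoc]
        | add d e hd he =>
          simp only [map_add, mul_add, hd, he]
          simp [eGen_add, tmul_add]
  rw [key, hcc, ← hW.a1, mul_one]

theorem rTensor_eq_of_lTensor_eq (hcc : Cocomm W) {f : H →ₗ[k] H} {h : H}
    (hf : LinearMap.lTensor H f (W.δ h) = W.δ h) : LinearMap.rTensor H f (W.δ h) = W.δ h := by
  have h := TensorProduct.map_comm f LinearMap.id (W.δ h)
  rw [hcc] at h
  rw [LinearMap.rTensor, h]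
  exact (congrArg (TensorProduct.comm k H H) hf).trans (hcc _)

theorem rTensor_PiL_δ_one (hW : IsWeakHopf W) (hcc : Cocomm W) :
    LinearMap.rTensor H (PiL W) (W.δ 1) = W.δ 1 :=
  rTensor_eq_of_lTensor_eq hcc <| by
    rw [lTensor_PiL_δ hW hcc, ← Algebra.TensorProduct.one_def, mul_one]

theorem rTensor_PiR_δ_one (hW : IsWeakHopf W) (hcc : Cocomm W) :
    LinearMap.rTensor H (PiR W) (W.δ 1) = W.δ 1 :=
  rTensor_eq_of_lTensor_eq hcc <| by
    rw [lTensor_PiR_δ hW hcc, ← Algebra.TensorProduct.one_def, one_mul]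

theorem comm_mul (s t : H ⊗[k] H) :
    TensorProduct.comm k H H (s * t) = TensorProduct.comm k H H s * TensorProduct.comm k H H t :=
  map_mul (Algebra.TensorProduct.comm k H H) s t

theorem IsBase.PiL_mul (hcc : Cocomm W) {x : H} (hx : IsBase W x) (h : H) :
    PiL W (x * h) = x * PiL W h := by
  have h1 : W.δ 1 * ((1 : H) ⊗ₜ[k] x) = (x ⊗ₜ[k] (1 : H)) * W.δ 1 := by
    rw [← hx.1, ← hcc x, hx.2, comm_mul, hcc]; rfl
  have h2 : ∀ t : H ⊗[k] H, dGen W t (x * h) = dGen W (t * ((1 : H) ⊗ₜ[k] x)) h := fun t => by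
    induction t using TensorProduct.induction_on with
    | zero => simp [dGen_zero]
    | tmul x y => simp [dGen_tmul, mul_assoc]
    | add t s ht hs => simp only [add_mul, dGen_add, ht, hs]
  have h3 : ∀ t : H ⊗[k] H, dGen W ((x ⊗ₜ[k] (1 : H)) * t) h = x * dGen W t h := fun t => by
    induction t using TensorProduct.induction_on with
    | zero => simp [dGen_zero]
    | tmul x y => simp [dGen_tmul]
    | add t s ht hs => simp only [mul_add, dGen_add, ht, hs]
  rw [PiL_eq_dGen hcc, h2, h1, h3]

theorem IsBase.PiR_mul (hcc : Cocomm W) {x : H} (hx : IsBase W x) (h : H) :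
    PiR W (h * x) = PiR W h * x := by
  have h1 : ((1 : H) ⊗ₜ[k] x) * W.δ 1 = W.δ 1 * (x ⊗ₜ[k] (1 : H)) := by
    rw [← hx.2, ← hcc x, hx.1, comm_mul, hcc]; rfl
  have h2 : ∀ t : H ⊗[k] H, eGen W t (h * x) = eGen W (((1 : H) ⊗ₜ[k] x) * t) h := fun t => by
    induction t using TensorProduct.induction_on with
    | zero => simp [eGen_zero]
    | tmul x y => simp [eGen_tmul, mul_assoc]
    | add t s ht hs => simp only [mul_add, eGen_add, ht, hs]
  have h3 : ∀ t : H ⊗[k] H, eGen W (t * (x ⊗ₜ[k] (1 : H))) h = eGen W t h * x := fun t => by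
    induction t using TensorProduct.induction_on with
    | zero => simp [eGen_zero]
    | tmul x y => simp [eGen_tmul]
    | add t s ht hs => simp only [add_mul, eGen_add, ht, hs]
  rw [PiR_eq_eGen, h2, h1, h3]

theorem δ_PiL (hW : IsWeakHopf W) (hcc : Cocomm W) (h : H) :
    W.δ (PiL W h) = TensorProduct.map (PiL W) (PiL W) (W.δ h) := by
  have h1 : TensorProduct.map (PiL W) (PiL W) (W.δ h) =
      LinearMap.rTensor H (PiL W) (LinearMap.lTensor H (PiL W) (W.δ h)) := by
    rw [← LinearMap.comp_apply (LinearMap.rTensor _ _), LinearMap.rTensor_comp_lTensor]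
  have h2 : ∀ t : H ⊗[k] H, LinearMap.rTensor H (PiL W)
      (LinearMap.rTensor H (PiL W) t * (h ⊗ₜ[k] (1 : H))) =
      LinearMap.rTensor H (PiL W) t * (PiL W h ⊗ₜ[k] (1 : H)) := fun t => by
    induction t using TensorProduct.induction_on with
    | zero => simp
    | tmul x y => simp [(isBase_PiL hW hcc x).PiL_mul hcc]
    | add t s ht hs => simp only [add_mul, map_add, ht, hs]
  have h3 := h2 (W.δ 1)
  rw [rTensor_PiL_δ_one hW hcc] at h3
  rw [h1, lTensor_PiL_δ hW hcc, h3]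
  exact (isBase_PiL hW hcc h).2

theorem δ_PiR (hW : IsWeakHopf W) (hcc : Cocomm W) (h : H) :
    W.δ (PiR W h) = TensorProduct.map (PiR W) (PiR W) (W.δ h) := by
  have h1 : TensorProduct.map (PiR W) (PiR W) (W.δ h) =
      LinearMap.rTensor H (PiR W) (LinearMap.lTensor H (PiR W) (W.δ h)) := by
    rw [← LinearMap.comp_apply (LinearMap.rTensor _ _), LinearMap.rTensor_comp_lTensor]
  have h2 : ∀ t : H ⊗[k] H, LinearMap.rTensor H (PiR W)
      ((h ⊗ₜ[k] (1 : H)) * LinearMap.rTensor H (PiR W) t) =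
      (PiR W h ⊗ₜ[k] (1 : H)) * LinearMap.rTensor H (PiR W) t := fun t => by
    induction t using TensorProduct.induction_on with
    | zero => simp
    | tmul x y => simp [(isBase_PiR hW hcc x).PiR_mul hcc]
    | add t s ht hs => simp only [mul_add, map_add, ht, hs]
  have h3 := h2 (W.δ 1)
  rw [rTensor_PiR_δ_one hW hcc] at h3
  rw [h1, lTensor_PiR_δ hW hcc, h3]
  exact (isBase_PiR hW hcc h).1

end Base

section Antipode

open Coalgebra

variable {k : Type} [CommRing k] {H : Type} [Ring H] [Algebra k H] [Coalgebra k H]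
  {W : HopfData k H}

theorem conv_id_lam (hW : IsWeakHopf W) (hδ : W.δ = comul) :
    conv k comul LinearMap.id W.lam = PiL W := by
  ext h
  rw [← hδ]
  exact hW.a4_left h

theorem conv_lam_id (hW : IsWeakHopf W) (hδ : W.δ = comul) :
    conv k comul W.lam LinearMap.id = PiR W := by
  ext h
  rw [← hδ]
  exact hW.a4_right h

theorem conv_PiR_lam (hW : IsWeakHopf W) (hδ : W.δ = comul) :
    conv k comul (PiR W) W.lam = W.lam := by
  rw [← conv_lam_id hW hδ, ← hδ]
  exact hW.a4_mid

theorem isPoint_id (hδ : W.δ = comul) : IsPoint W (LinearMap.id : H →ₗ[k] H) := by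
  ext h
  simp [pair, hδ]

theorem isPoint_PiL (hW : IsWeakHopf W) (hcc : Cocomm W) (hδ : W.δ = comul) :
    IsPoint W (PiL W) := by
  ext h
  simp [pair, ← hδ, δ_PiL hW hcc]

theorem isPoint_PiR (hW : IsWeakHopf W) (hcc : Cocomm W) (hδ : W.δ = comul) :
    IsPoint W (PiR W) := by
  ext h
  simp [pair, ← hδ, δ_PiR hW hcc]

theorem conv_PiL_id (hW : IsWeakHopf W) (hcc : Cocomm W) (hδ : W.δ = comul) :
    conv k comul (PiL W) LinearMap.id = LinearMap.id := by
  have key : ∀ t d : H ⊗[k] H,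
      LinearMap.mul' k H (TensorProduct.map (dGen W (TensorProduct.comm k H H t)) LinearMap.id d) =
        TensorProduct.lid k H (LinearMap.rTensor H W.ε (t * d)) := fun t d => by
    induction d using TensorProduct.induction_on with
    | zero => simp
    | add d e hd he => simp only [map_add, mul_add, hd, he]
    | tmul u v =>
      induction t using TensorProduct.induction_on with
      | zero => simp [dGen_zero]
      | tmul x y => simp [dGen_tmul]
      | add d e hd he =>
        simp only [map_add, add_mul, ← hd, ← he]
        simp [dGen_add, add_mul]
  ext h
  have h1 := key (W.δ 1) (W.δ h)
  rw [hcc, ← PiL_eq_dGen hcc, ← hW.a1, one_mul, hW.counit_left, hδ] at h1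
  exact h1

theorem conv_id_PiR (hW : IsWeakHopf W) (hcc : Cocomm W) (hδ : W.δ = comul) :
    conv k comul LinearMap.id (PiR W) = LinearMap.id := by
  rw [← conv_lam_id hW hδ, ← conv_assoc, conv_id_lam hW hδ, conv_PiL_id hW hcc hδ]

variable [IsCocomm k H]

theorem isPoint_lam (hW : IsWeakHopf W) (hcc : Cocomm W) (hδ : W.δ = comul) :
    IsPoint W W.lam := by
  have hid : pair (C := H) (LinearMap.id : H →ₗ[k] H) (LinearMap.id : H →ₗ[k] H) = W.δ :=
    (isPoint_id hδ).symm
  have hXD : conv k comul (W.δ ∘ₗ W.lam) W.δ = pair (PiR W) (PiR W) := by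
    rw [← isPoint_PiR hW hcc hδ, ← conv_lam_id hW hδ, δ_comp_conv hW, LinearMap.comp_id]
  have hYD : conv k comul (pair W.lam W.lam) W.δ = pair (PiR W) (PiR W) := by
    rw [← hid, mul_pair_pair, conv_lam_id hW hδ]
  have hDX : conv k comul W.δ (W.δ ∘ₗ W.lam) = pair (PiL W) (PiL W) := by
    rw [← isPoint_PiL hW hcc hδ, ← conv_id_lam hW hδ, δ_comp_conv hW, LinearMap.comp_id]
  have hDY : conv k comul W.δ (pair W.lam W.lam) = pair (PiL W) (PiL W) := by
    rw [← hid, mul_pair_pair, conv_id_lam hW hδ]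
  calc W.δ ∘ₗ W.lam
      = conv k comul (conv k comul (W.δ ∘ₗ W.lam) W.δ) (W.δ ∘ₗ W.lam) := by
        rw [hXD, ← isPoint_PiR hW hcc hδ, ← δ_comp_conv hW, conv_PiR_lam hW hδ]
    _ = conv k comul (conv k comul (pair W.lam W.lam) W.δ) (pair W.lam W.lam) := by
        rw [hXD, ← hYD, conv_assoc, hDX, conv_assoc, hDY]
    _ = pair W.lam W.lam := by
        rw [hYD, mul_pair_pair, conv_PiR_lam hW hδ]

end Antipode

section Crossed

open Coalgebra

variable {k : Type} [CommRing k] {C : Type} [AddCommGroup C] [Module k C] [Coalgebra k C]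
variable {H A : Type} [Ring H] [Algebra k H] [Ring A] [Algebra k A]
variable {W : HopfData k H} {φ : H ⊗[k] A →ₗ[k] A} {σ σinv : H ⊗[k] H →ₗ[k] A}

theorem u1_comp_conv (hφ : IsWeakModAlg W φ) (α β : C →ₗ[k] H) :
    u1 φ ∘ₗ conv k comul α β = φ ∘ₗ pair α (u1 φ ∘ₗ β) := by
  have h : u1 φ ∘ₗ LinearMap.mul' k H = φ ∘ₗ LinearMap.lTensor H (u1 φ) := by
    ext x y; simpa [u1] using hφ.2.2.1 x y
  rw [conv_eq_comp_pair, ← LinearMap.comp_assoc, h]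
  ext c
  simp [lTensor_pair]

theorem apply_isBase (hW : IsWeakHopf W) (hcc : Cocomm W) (hφ : IsWeakModAlg W φ) {x : H}
    (hx : IsBase W x) (b : A) : φ (x ⊗ₜ[k] b) = u1 φ x * b := by
  have h := hφ.2.2.2 x b
  rwa [hx.PiL_eq hW hcc] at h

theorem u1_base_mul (hW : IsWeakHopf W) (hcc : Cocomm W) (hφ : IsWeakModAlg W φ) {x : H}
    (hx : IsBase W x) (h : H) : u1 φ (x * h) = u1 φ x * u1 φ h := by
  rw [← apply_isBase hW hcc hφ hx]
  exact hφ.2.2.1 x h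

theorem u1_comp_PiL (hφ : IsWeakModAlg W φ) : u1 φ ∘ₗ PiL W = u1 φ := by
  ext h
  simpa [u1] using hφ.2.2.2 h 1

theorem comp_pair_isBase (hW : IsWeakHopf W) (hcc : Cocomm W) (hφ : IsWeakModAlg W φ)
    {π : H →ₗ[k] H} (hπ : ∀ h, IsBase W (π h)) (γ : C →ₗ[k] H) (b : C →ₗ[k] A) :
    φ ∘ₗ pair (π ∘ₗ γ) b = conv k comul (u1 φ ∘ₗ π ∘ₗ γ) b := by
  have h : φ ∘ₗ LinearMap.rTensor A π =
      LinearMap.mul' k A ∘ₗ LinearMap.rTensor A (u1 φ ∘ₗ π) := by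
    ext x b; simp [apply_isBase hW hcc hφ (hπ x)]
  ext c
  have := LinearMap.congr_fun h (pair γ b c)
  simp only [LinearMap.comp_apply, rTensor_pair] at this
  exact this

/-- The elementwise form of `u₂ ∧ σ = σ`. -/
theorem conv_u2_apply (hσ : IsRegPair2 W φ σ σinv) (x y : H) :
    LinearMap.mul' k A (TensorProduct.map (u2 φ) σ
      (TensorProduct.tensorTensorTensorComm k H H H H (W.δ x ⊗ₜ[k] W.δ y))) = σ (x ⊗ₜ[k] y) := by
  have h := hσ.2.2.1
  rw [hσ.1] at h
  exact LinearMap.congr_fun h (x ⊗ₜ[k] y)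

theorem cocycle_base_left (hW : IsWeakHopf W) (hcc : Cocomm W) (hcs : IsCrossedSystem W φ σ σinv)
    {x : H} (hx : IsBase W x) (z : H) : σ (x ⊗ₜ[k] z) = u1 φ (x * z) := by
  obtain ⟨hφ, hσ, -, -, hn⟩ := hcs
  have key : ∀ t d : H ⊗[k] H, LinearMap.mul' k A (TensorProduct.map (u2 φ) σ
      (TensorProduct.tensorTensorTensorComm k H H H H (((x ⊗ₜ[k] (1 : H)) * t) ⊗ₜ[k] d))) =
      u1 φ x * LinearMap.mul' k A (TensorProduct.map (u2 φ) σ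
        (TensorProduct.tensorTensorTensorComm k H H H H (t ⊗ₜ[k] d))) := fun t d => by
    induction d using TensorProduct.induction_on with
    | zero => simp
    | add d e hd he => simp only [tmul_add, map_add, mul_add, hd, he]
    | tmul u v =>
      induction t using TensorProduct.induction_on with
      | zero => simp
      | add d e hd he => simp only [add_tmul, map_add, mul_add, hd, he]
      | tmul a b => simp [u2, mul_assoc, u1_base_mul hW hcc hφ hx]
  rw [← conv_u2_apply hσ, hx.1, key, conv_u2_apply hσ, (hn z).2, u1_base_mul hW hcc hφ hx]

theorem cocycle_base_right (hW : IsWeakHopf W) (hcs : IsCrossedSystem W φ σ σinv)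
    {x : H} (hx : IsBase W x) (h : H) : σ (h ⊗ₜ[k] x) = u1 φ (h * x) := by
  obtain ⟨hφ, hσ, -, -, hn⟩ := hcs
  have key : ∀ t d : H ⊗[k] H, LinearMap.mul' k A (TensorProduct.map (u2 φ) σ
      (TensorProduct.tensorTensorTensorComm k H H H H (d ⊗ₜ[k] ((x ⊗ₜ[k] (1 : H)) * t)))) =
      LinearMap.mul' k A (TensorProduct.map (u2 φ) σ
        (TensorProduct.tensorTensorTensorComm k H H H H
          ((d * (x ⊗ₜ[k] (1 : H))) ⊗ₜ[k] t))) := fun t d => by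
    induction d using TensorProduct.induction_on with
    | zero => simp
    | add d e hd he => simp only [add_tmul, map_add, add_mul, hd, he]
    | tmul u v =>
      induction t using TensorProduct.induction_on with
      | zero => simp
      | add d e hd he => simp only [tmul_add, map_add, mul_add, hd, he]
      | tmul a b => simp [u2, mul_assoc]
  have hhx : W.δ (h * x) = W.δ h * (x ⊗ₜ[k] (1 : H)) := by
    rw [hW.a1, hx.2, ← mul_assoc, ← hW.a1, mul_one]
  rw [← conv_u2_apply hσ, hx.1, key, ← hhx, conv_u2_apply hσ, (hn _).1]

theorem cocycle_pair_base_left (hW : IsWeakHopf W) (hcc : Cocomm W)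
    (hcs : IsCrossedSystem W φ σ σinv) {π : H →ₗ[k] H} (hπ : ∀ h, IsBase W (π h))
    (γ β : C →ₗ[k] H) : σ ∘ₗ pair (π ∘ₗ γ) β = u1 φ ∘ₗ conv k comul (π ∘ₗ γ) β := by
  have h : σ ∘ₗ LinearMap.rTensor H π = u1 φ ∘ₗ LinearMap.mul' k H ∘ₗ LinearMap.rTensor H π := by
    ext x z; simp [cocycle_base_left hW hcc hcs (hπ x)]
  ext c
  have := LinearMap.congr_fun h (pair γ β c)
  simp only [LinearMap.comp_apply, rTensor_pair] at this
  exact this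

theorem cocycle_pair_base_right (hW : IsWeakHopf W)
    (hcs : IsCrossedSystem W φ σ σinv) {π : H →ₗ[k] H} (hπ : ∀ h, IsBase W (π h))
    (α γ : C →ₗ[k] H) : σ ∘ₗ pair α (π ∘ₗ γ) = u1 φ ∘ₗ conv k comul α (π ∘ₗ γ) := by
  have h : σ ∘ₗ LinearMap.lTensor H π = u1 φ ∘ₗ LinearMap.mul' k H ∘ₗ LinearMap.lTensor H π := by
    ext x z; simp [cocycle_base_right hW hcs (hπ z)]
  ext c
  have := LinearMap.congr_fun h (pair α γ c)
  simp only [LinearMap.comp_apply, lTensor_pair] at this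
  exact this

variable [IsCocomm k C]

theorem pair_convOne_right {Y : Type} [AddCommGroup Y] [Module k Y] (a : C →ₗ[k] Y) :
    pair a (convOne k C A) = (TensorProduct.mk k Y A).flip 1 ∘ₗ a := by
  ext c
  rw [← comm_pair, pair_convOne_left]
  rfl

theorem comp_pair_convOne (α : C →ₗ[k] H) : φ ∘ₗ pair α (convOne k C A) = u1 φ ∘ₗ α := by
  rw [pair_convOne_right]
  rfl

theorem comp_pair_conv (hφ : IsWeakModAlg W φ) {α : C →ₗ[k] H} (hα : IsPoint W α)
    (a b : C →ₗ[k] A) :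
    φ ∘ₗ pair α (conv k comul a b) = conv k comul (φ ∘ₗ pair α a) (φ ∘ₗ pair α b) := by
  have h : φ ∘ₗ LinearMap.lTensor H (LinearMap.mul' k A) =
      LinearMap.mul' k A ∘ₗ TensorProduct.map φ φ ∘ₗ
        (TensorProduct.tensorTensorTensorComm k H H A A).toLinearMap ∘ₗ
        LinearMap.rTensor (A ⊗[k] A) W.δ := by
    ext x b c
    have h' := hφ.2.1 x b c
    simp only [AlgebraTensorModule.curry_apply, LinearMap.restrictScalars_self, curry_apply,
      LinearMap.comp_apply, LinearMap.lTensor_tmul, LinearMap.rTensor_tmul, LinearMap.mul'_apply,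
      LinearEquiv.coe_coe]
    rw [h']
    generalize W.δ x = t
    induction t using TensorProduct.induction_on with
    | zero => simp
    | tmul u v => simp
    | add t s ht hs => simp only [add_tmul, map_add, ht, hs]
  ext c
  have h1 := LinearMap.congr_fun h (pair α (pair a b) c)
  simp only [LinearMap.comp_apply, lTensor_pair, rTensor_pair, LinearEquiv.coe_coe] at h1
  rw [hα, tensorTensorTensorComm_pair, map_pair] at h1
  exact h1

theorem u1_conv_comp_pair (hφ : IsWeakModAlg W φ) {α : C →ₗ[k] H} (hα : IsPoint W α)
    (b : C →ₗ[k] A) :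
    conv k comul (u1 φ ∘ₗ α) (φ ∘ₗ pair α b) = φ ∘ₗ pair α b := by
  rw [← comp_pair_convOne, ← comp_pair_conv hφ hα, convOne_conv]

theorem u1_conv_u1_conv (hφ : IsWeakModAlg W φ) {α : C →ₗ[k] H} (hα : IsPoint W α)
    (β : C →ₗ[k] H) :
    conv k comul (u1 φ ∘ₗ α) (u1 φ ∘ₗ conv k comul α β) = u1 φ ∘ₗ conv k comul α β := by
  rw [u1_comp_conv hφ, u1_conv_comp_pair hφ hα]

section Regular

variable {α β : C →ₗ[k] H}

theorem cocycle_conv_inv (hσ : IsRegPair2 W φ σ σinv) (hα : IsPoint W α)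
    (hβ : IsPoint W β) :
    conv k comul (σ ∘ₗ pair α β) (σinv ∘ₗ pair α β) = u1 φ ∘ₗ conv k comul α β := by
  rw [← conv_comp (δ2_pair hα hβ), hσ.1]
  rfl

theorem inv_conv_cocycle (hσ : IsRegPair2 W φ σ σinv) (hα : IsPoint W α)
    (hβ : IsPoint W β) :
    conv k comul (σinv ∘ₗ pair α β) (σ ∘ₗ pair α β) = u1 φ ∘ₗ conv k comul α β := by
  rw [← conv_comp (δ2_pair hα hβ), hσ.2.1]
  rfl

theorem u1_conv_cocycle (hσ : IsRegPair2 W φ σ σinv) (hα : IsPoint W α)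
    (hβ : IsPoint W β) :
    conv k comul (u1 φ ∘ₗ conv k comul α β) (σ ∘ₗ pair α β) = σ ∘ₗ pair α β := by
  rw [← cocycle_conv_inv hσ hα hβ, ← conv_comp (δ2_pair hα hβ), ← conv_comp (δ2_pair hα hβ),
    hσ.2.2.1]

theorem cocycle_conv_u1 (hσ : IsRegPair2 W φ σ σinv) (hα : IsPoint W α)
    (hβ : IsPoint W β) :
    conv k comul (σ ∘ₗ pair α β) (u1 φ ∘ₗ conv k comul α β) = σ ∘ₗ pair α β := by
  rw [← inv_conv_cocycle hσ hα hβ, ← conv_assoc, cocycle_conv_inv hσ hα hβ,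
    u1_conv_cocycle hσ hα hβ]

theorem u1_conv_inv (hσ : IsRegPair2 W φ σ σinv) (hα : IsPoint W α)
    (hβ : IsPoint W β) :
    conv k comul (u1 φ ∘ₗ conv k comul α β) (σinv ∘ₗ pair α β) = σinv ∘ₗ pair α β := by
  rw [← inv_conv_cocycle hσ hα hβ, ← conv_comp (δ2_pair hα hβ), ← conv_comp (δ2_pair hα hβ),
    hσ.2.2.2]

end Regular

theorem cocycle_points (hg2 : CrossedG2 W φ σ) {α β γ : C →ₗ[k] H}
    (hα : IsPoint W α) (hβ : IsPoint W β) (hγ : IsPoint W γ) (hε : W.ε ∘ₗ γ = counit) :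
    conv k comul (φ ∘ₗ pair α (σ ∘ₗ pair β γ)) (σ ∘ₗ pair α (conv k comul β γ)) =
      conv k comul (σ ∘ₗ pair α β) (σ ∘ₗ pair (conv k comul α β) γ) := by
  have h := congrArg (fun F => F ∘ₗ pair α (pair β γ)) hg2
  simp only [conv_comp (δ3_pair hα hβ hγ), LinearMap.comp_assoc] at h
  have hmap : TensorProduct.map σ W.ε ∘ₗ pair (pair α β) γ = pair (σ ∘ₗ pair α β) counit := by
    ext c
    rw [LinearMap.comp_apply, map_pair, hε]
  rw [lTensor_comp_pair, lTensor_comp_pair, assoc_symm_comp_pair, rTensor_comp_pair, hmap,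
    rid_comp_pair_counit] at h
  exact h

theorem ψmap_pair {α : C →ₗ[k] H} (hα : IsPoint W α) (b : C →ₗ[k] A) :
    ψmap W φ ∘ₗ pair α b = pair (φ ∘ₗ pair α b) α := by
  simp only [ψmap, LinearMap.comp_assoc]
  rw [rTensor_comp_pair, hα, assoc_comp_pair, lTensor_comp_pair, comm_comp_pair,
    assoc_symm_comp_pair, rTensor_comp_pair]

theorem nabla_pair (a : C →ₗ[k] A) {α : C →ₗ[k] H} (hα : IsPoint W α) :
    nabla W φ ∘ₗ pair a α = pair (conv k comul a (u1 φ ∘ₗ α)) α := by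
  simp only [nabla, LinearMap.comp_assoc]
  rw [lTensor_comp_pair, ← pair_convOne_right, lTensor_comp_pair, ψmap_pair hα,
    comp_pair_convOne, assoc_symm_comp_pair, rTensor_comp_pair]
  rfl

theorem σHA_pair {α β : C →ₗ[k] H} (hα : IsPoint W α) (hβ : IsPoint W β) :
    σHA W σ ∘ₗ pair α β = pair (σ ∘ₗ pair α β) (conv k comul α β) := by
  rw [σHA, LinearMap.comp_assoc, δ2_pair hα hβ]
  ext c
  rw [LinearMap.comp_apply, map_pair]
  rfl

theorem crossmulAmb_pair (a b : C →ₗ[k] A) {α β : C →ₗ[k] H} (hα : IsPoint W α)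
    (hβ : IsPoint W β) :
    crossmulAmb W φ σ ∘ₗ pair (pair a α) (pair b β) =
      pair (conv k comul a (conv k comul (φ ∘ₗ pair α b) (σ ∘ₗ pair α β)))
        (conv k comul α β) := by
  simp only [crossmulAmb, LinearMap.comp_assoc]
  simp only [assoc_comp_pair, lTensor_comp_pair, assoc_symm_comp_pair, rTensor_comp_pair,
    ψmap_pair hα, σHA_pair hα hβ]
  rfl

end Crossed

section CrossedProduct

open Coalgebra

variable {k : Type} [CommRing k] {C : Type} [AddCommGroup C] [Module k C] [Coalgebra k C]
variable {H A P : Type} [Ring H] [Algebra k H] [Ring A] [Algebra k A] [AddCommGroup P] [Module k P]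
variable {W : HopfData k H} {φ : H ⊗[k] A →ₗ[k] A} {σ σinv : H ⊗[k] H →ₗ[k] A}
  {p : A ⊗[k] H →ₗ[k] P} {ι : P →ₗ[k] A ⊗[k] H}

theorem mk_one_comp (α : C →ₗ[k] H) :
    (p ∘ₗ TensorProduct.mk k A H 1) ∘ₗ α = p ∘ₗ pair (convOne k C A) α := by
  ext c
  simp [pair_convOne_left]

variable [IsCocomm k C]

theorem proj_comp_pair_conv_u1 (hsplit : ι ∘ₗ p = nabla W φ) (hretr : p ∘ₗ ι = LinearMap.id)
    (a : C →ₗ[k] A) {α : C →ₗ[k] H} (hα : IsPoint W α) :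
    p ∘ₗ pair (conv k comul a (u1 φ ∘ₗ α)) α = p ∘ₗ pair a α := by
  rw [← nabla_pair a hα, ← hsplit, ← LinearMap.comp_assoc, ← LinearMap.comp_assoc, hretr,
    LinearMap.id_comp]

theorem proj_comp_pair_u1 (hsplit : ι ∘ₗ p = nabla W φ) (hretr : p ∘ₗ ι = LinearMap.id)
    {α : C →ₗ[k] H} (hα : IsPoint W α) :
    p ∘ₗ pair (u1 φ ∘ₗ α) α = (p ∘ₗ TensorProduct.mk k A H 1) ∘ₗ α := by
  have h := proj_comp_pair_conv_u1 hsplit hretr (convOne k C A) hα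
  rw [convOne_conv] at h
  rw [h, mk_one_comp]

theorem crossMul_comp_pair (hφ : IsWeakModAlg W φ) (hσ : IsRegPair2 W φ σ σinv)
    (hsplit : ι ∘ₗ p = nabla W φ) (a b : C →ₗ[k] A) {α β : C →ₗ[k] H}
    (hα : IsPoint W α) (hβ : IsPoint W β) :
    crossMul W φ σ p ι ∘ₗ pair (p ∘ₗ pair a α) (p ∘ₗ pair b β) =
      p ∘ₗ pair (conv k comul a (conv k comul (φ ∘ₗ pair α b) (σ ∘ₗ pair α β)))
        (conv k comul α β) := by
  have hι : TensorProduct.map ι ι ∘ₗ pair (p ∘ₗ pair a α) (p ∘ₗ pair b β) =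
      pair (pair (conv k comul a (u1 φ ∘ₗ α)) α) (pair (conv k comul b (u1 φ ∘ₗ β)) β) := by
    ext c
    rw [LinearMap.comp_apply, map_pair, ← LinearMap.comp_assoc, ← LinearMap.comp_assoc, hsplit,
      nabla_pair a hα, nabla_pair b hβ]
  rw [crossMul, LinearMap.comp_assoc, LinearMap.comp_assoc, hι, crossmulAmb_pair _ _ hα hβ,
    comp_pair_conv hφ hα, ← u1_comp_conv hφ, conv_assoc, conv_assoc (φ ∘ₗ pair α b),
    u1_conv_cocycle hσ hα hβ, ← conv_assoc (u1 φ ∘ₗ α), u1_conv_comp_pair hφ hα]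

theorem crossCoact_comp_pair (hsplit : ι ∘ₗ p = nabla W φ) (hretr : p ∘ₗ ι = LinearMap.id)
    (a : C →ₗ[k] A) {α : C →ₗ[k] H} (hα : IsPoint W α) :
    crossCoact W p ι ∘ₗ p ∘ₗ pair a α = pair (p ∘ₗ pair a α) α := by
  rw [crossCoact, LinearMap.comp_assoc, LinearMap.comp_assoc, LinearMap.comp_assoc,
    ← LinearMap.comp_assoc (pair a α) p ι, hsplit, nabla_pair a hα, lTensor_comp_pair, hα,
    assoc_symm_comp_pair, rTensor_comp_pair, proj_comp_pair_conv_u1 hsplit hretr a hα]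

theorem crossMul_base_left (hW : IsWeakHopf W) (hcc : Cocomm W)
    (hcs : IsCrossedSystem W φ σ σinv)
    (hsplit : ι ∘ₗ p = nabla W φ) (hretr : p ∘ₗ ι = LinearMap.id) {π : H →ₗ[k] H}
    (hπ : ∀ h, IsBase W (π h)) {γ β : C →ₗ[k] H} (hγ : IsPoint W (π ∘ₗ γ)) (hβ : IsPoint W β) :
    crossMul W φ σ p ι ∘ₗ pair ((p ∘ₗ TensorProduct.mk k A H 1) ∘ₗ π ∘ₗ γ)
        ((p ∘ₗ TensorProduct.mk k A H 1) ∘ₗ β) =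
      (p ∘ₗ TensorProduct.mk k A H 1) ∘ₗ conv k comul (π ∘ₗ γ) β := by
  rw [mk_one_comp, mk_one_comp, crossMul_comp_pair hcs.1 hcs.2.1 hsplit _ _ hγ hβ, convOne_conv,
    comp_pair_convOne, cocycle_pair_base_left hW hcc hcs hπ, u1_conv_u1_conv hcs.1 hγ,
    proj_comp_pair_u1 hsplit hretr (hγ.conv hW hβ)]

end CrossedProduct

section Cleaving

open Coalgebra

variable {k : Type} [CommRing k]
variable {H A P : Type} [Ring H] [Algebra k H] [Ring A] [Algebra k A] [AddCommGroup P] [Module k P]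
variable [Coalgebra k H]
variable {W : HopfData k H} {φ : H ⊗[k] A →ₗ[k] A} {σ σinv : H ⊗[k] H →ₗ[k] A}
  {p : A ⊗[k] H →ₗ[k] P} {ι : P →ₗ[k] A ⊗[k] H}

theorem convG_eq_comp_pair (hδ : W.δ = comul) (m : P ⊗[k] P →ₗ[k] P) (f g : H →ₗ[k] P) :
    convG k W.δ m f g = m ∘ₗ pair f g := by
  rw [hδ]; rfl

theorem integral_eq :
    p ∘ₗ TensorProduct.mk k A H 1 = p ∘ₗ pair (convOne k H A) LinearMap.id := by
  rw [← mk_one_comp, LinearMap.comp_id]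

variable [IsCocomm k H]

theorem action_inv_conv_cocycle (hW : IsWeakHopf W) (hcc : Cocomm W) (hδ : W.δ = comul)
    (hε : W.ε = counit) (hcs : IsCrossedSystem W φ σ σinv) :
    conv k comul (φ ∘ₗ pair LinearMap.id (σinv ∘ₗ pair W.lam LinearMap.id))
      (σ ∘ₗ pair LinearMap.id W.lam) = u1 φ := by
  obtain ⟨hφ, hσ, -, hg2, -⟩ := id hcs
  have hid := isPoint_id (W := W) hδ
  have hlam := isPoint_lam hW hcc hδ
  have h := cocycle_points hg2 hid hlam hid hε
  rw [conv_lam_id hW hδ, conv_id_lam hW hδ] at h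
  have hR := cocycle_pair_base_right hW hcs (isBase_PiR hW hcc) LinearMap.id LinearMap.id
  have hL := cocycle_pair_base_left hW hcc hcs (isBase_PiL hW hcc) LinearMap.id LinearMap.id
  rw [LinearMap.comp_id] at hR hL
  rw [conv_id_PiR hW hcc hδ, LinearMap.comp_id] at hR
  rw [conv_PiL_id hW hcc hδ, LinearMap.comp_id] at hL
  have hσu := cocycle_conv_u1 hσ hid hlam
  rw [conv_id_lam hW hδ, u1_comp_PiL hφ] at hσu
  have huu := u1_conv_u1_conv hφ hid (PiR W)
  rw [conv_id_PiR hW hcc hδ, LinearMap.comp_id] at huu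
  rw [hR, hL, hσu] at h
  rw [← h, ← conv_assoc, ← comp_pair_conv hφ hid, inv_conv_cocycle hσ hlam hid,
    conv_lam_id hW hδ, ← u1_comp_conv hφ, conv_id_PiR hW hcc hδ, LinearMap.comp_id, huu]

theorem integral_conv_inv (hW : IsWeakHopf W) (hcc : Cocomm W) (hδ : W.δ = comul)
    (hε : W.ε = counit) (hcs : IsCrossedSystem W φ σ σinv)
    (hsplit : ι ∘ₗ p = nabla W φ) (hretr : p ∘ₗ ι = LinearMap.id) :
    convG k W.δ (crossMul W φ σ p ι) (p ∘ₗ TensorProduct.mk k A H 1)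
      (p ∘ₗ pair (σinv ∘ₗ pair W.lam LinearMap.id) W.lam) =
      (p ∘ₗ TensorProduct.mk k A H 1) ∘ₗ PiL W := by
  rw [← proj_comp_pair_u1 hsplit hretr (isPoint_PiL hW hcc hδ), u1_comp_PiL hcs.1,
    convG_eq_comp_pair hδ, integral_eq,
    crossMul_comp_pair hcs.1 hcs.2.1 hsplit _ _ (isPoint_id hδ) (isPoint_lam hW hcc hδ),
    convOne_conv, action_inv_conv_cocycle hW hcc hδ hε hcs, conv_id_lam hW hδ]

theorem inv_conv_integral (hW : IsWeakHopf W) (hcc : Cocomm W) (hδ : W.δ = comul)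
    (hcs : IsCrossedSystem W φ σ σinv)
    (hsplit : ι ∘ₗ p = nabla W φ) (hretr : p ∘ₗ ι = LinearMap.id) :
    convG k W.δ (crossMul W φ σ p ι) (p ∘ₗ pair (σinv ∘ₗ pair W.lam LinearMap.id) W.lam)
      (p ∘ₗ TensorProduct.mk k A H 1) = (p ∘ₗ TensorProduct.mk k A H 1) ∘ₗ PiR W := by
  have hid := isPoint_id (W := W) hδ
  have hlam := isPoint_lam hW hcc hδ
  have hu : conv k comul (u1 φ ∘ₗ W.lam) (σ ∘ₗ pair W.lam LinearMap.id) =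
      σ ∘ₗ pair W.lam LinearMap.id := by
    rw [← u1_conv_cocycle hcs.2.1 hlam hid, ← conv_assoc, u1_conv_u1_conv hcs.1 hlam]
  rw [← proj_comp_pair_u1 hsplit hretr (isPoint_PiR hW hcc hδ), convG_eq_comp_pair hδ, integral_eq,
    crossMul_comp_pair hcs.1 hcs.2.1 hsplit _ _ hlam hid, comp_pair_convOne, hu,
    inv_conv_cocycle hcs.2.1 hlam hid, conv_lam_id hW hδ]

theorem base_conv_inv (hW : IsWeakHopf W) (hcc : Cocomm W) (hδ : W.δ = comul)
    (hcs : IsCrossedSystem W φ σ σinv)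
    (hsplit : ι ∘ₗ p = nabla W φ) (hretr : p ∘ₗ ι = LinearMap.id) :
    convG k W.δ (crossMul W φ σ p ι) ((p ∘ₗ TensorProduct.mk k A H 1) ∘ₗ PiR W)
      (p ∘ₗ pair (σinv ∘ₗ pair W.lam LinearMap.id) W.lam) =
      p ∘ₗ pair (σinv ∘ₗ pair W.lam LinearMap.id) W.lam := by
  have hid := isPoint_id (W := W) hδ
  have hlam := isPoint_lam hW hcc hδ
  have hφR := comp_pair_isBase hW hcc hcs.1 (isBase_PiR hW hcc) LinearMap.id
    (σinv ∘ₗ pair W.lam LinearMap.id)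
  have hσR := cocycle_pair_base_left hW hcc hcs (isBase_PiR hW hcc) LinearMap.id W.lam
  have hu := u1_conv_inv hcs.2.1 hlam hid
  rw [LinearMap.comp_id] at hφR hσR
  rw [conv_lam_id hW hδ] at hu
  rw [convG_eq_comp_pair hδ, mk_one_comp,
    crossMul_comp_pair hcs.1 hcs.2.1 hsplit _ _ (isPoint_PiR hW hcc hδ) hlam, convOne_conv,
    hφR, hu, hσR, conv_PiR_lam hW hδ, proj_comp_pair_conv_u1 hsplit hretr _ hlam]

theorem crossCoact_integral (hδ : W.δ = comul)
    (hsplit : ι ∘ₗ p = nabla W φ) (hretr : p ∘ₗ ι = LinearMap.id) (h : H) :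
    crossCoact W p ι ((p ∘ₗ TensorProduct.mk k A H 1) h) =
      LinearMap.rTensor H (p ∘ₗ TensorProduct.mk k A H 1) (W.δ h) := by
  have hid := isPoint_id (W := W) hδ
  have h1 := LinearMap.congr_fun
    (crossCoact_comp_pair (W := W) hsplit hretr (convOne k H A) hid) h
  rw [← mk_one_comp, LinearMap.comp_id] at h1
  have h2 := rTensor_pair (p ∘ₗ TensorProduct.mk k A H 1) LinearMap.id LinearMap.id h
  rw [← hid] at h2
  exact h1.trans h2.symm

end Cleaving

section TensorSquare

open Coalgebra

variable {k : Type} [CommRing k] {H : Type} [AddCommGroup H] [Module k H] [Coalgebra k H]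

/-- The first tensor factor, as a map out of the tensor square of a coalgebra. -/
def fst (k H : Type) [CommRing k] [AddCommGroup H] [Module k H] [Coalgebra k H] :
    H ⊗[k] H →ₗ[k] H :=
  (TensorProduct.rid k H).toLinearMap ∘ₗ LinearMap.lTensor H counit

/-- The second tensor factor, as a map out of the tensor square of a coalgebra. -/
def snd (k H : Type) [CommRing k] [AddCommGroup H] [Module k H] [Coalgebra k H] :
    H ⊗[k] H →ₗ[k] H :=
  (TensorProduct.lid k H).toLinearMap ∘ₗ LinearMap.rTensor H counit

theorem pair_tensorSquare_tmul {X Y : Type} [AddCommGroup X] [Module k X] [AddCommGroup Y]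
    [Module k Y] (a : H ⊗[k] H →ₗ[k] X) (b : H ⊗[k] H →ₗ[k] Y) (x y : H) :
    pair a b (x ⊗ₜ[k] y) = TensorProduct.map a b
      (TensorProduct.tensorTensorTensorComm k H H H H (comul x ⊗ₜ[k] comul y)) :=
  rfl

theorem pair_fst_snd_tmul (x y : H) : pair (fst k H) (snd k H) (x ⊗ₜ[k] y) = x ⊗ₜ[k] y := by
  have key : ∀ s t : H ⊗[k] H, TensorProduct.map (fst k H) (snd k H)
      (TensorProduct.tensorTensorTensorComm k H H H H (s ⊗ₜ[k] t)) =
      fst k H s ⊗ₜ[k] snd k H t := fun s t => by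
    induction s using TensorProduct.induction_on with
    | zero => simp
    | add s r hs hr => simp only [add_tmul, map_add, hs, hr]
    | tmul a b =>
      induction t using TensorProduct.induction_on with
      | zero => simp
      | add s r hs hr => simp only [tmul_add, map_add, hs, hr]
      | tmul c d => simp [fst, snd, smul_tmul', tmul_smul, smul_smul, mul_comm]
  rw [pair_tensorSquare_tmul, key]
  simp [fst, snd]

theorem comul_fst : comul ∘ₗ fst k H = pair (fst k H) (fst k H) := by
  have key : ∀ s t : H ⊗[k] H, TensorProduct.map (fst k H) (fst k H)
      (TensorProduct.tensorTensorTensorComm k H H H H (s ⊗ₜ[k] t)) =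
      counit (R := k) (snd k H t) • s := fun s t => by
    induction s using TensorProduct.induction_on with
    | zero => simp
    | add s r hs hr => simp only [add_tmul, map_add, smul_add, hs, hr]
    | tmul a b =>
      induction t using TensorProduct.induction_on with
      | zero => simp
      | add s r hs hr => simp only [tmul_add, map_add, add_smul, hs, hr]
      | tmul c d => simp [fst, snd, smul_tmul', tmul_smul, smul_smul, mul_comm]
  ext x y
  have h := key (comul x) (comul y)
  rw [← pair_tensorSquare_tmul] at h
  refine Eq.trans ?_ h.symm
  simp [fst, snd]

theorem comul_snd : comul ∘ₗ snd k H = pair (snd k H) (snd k H) := by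
  have key : ∀ s t : H ⊗[k] H, TensorProduct.map (snd k H) (snd k H)
      (TensorProduct.tensorTensorTensorComm k H H H H (s ⊗ₜ[k] t)) =
      counit (R := k) (snd k H s) • t := fun s t => by
    induction s using TensorProduct.induction_on with
    | zero => simp
    | add s r hs hr => simp only [add_tmul, map_add, add_smul, hs, hr]
    | tmul a b =>
      induction t using TensorProduct.induction_on with
      | zero => simp
      | add s r hs hr => simp only [tmul_add, map_add, smul_add, hs, hr]
      | tmul c d => simp [snd, smul_tmul', tmul_smul, smul_smul, mul_comm]
  ext x y
  have h := key (comul x) (comul y)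
  rw [← pair_tensorSquare_tmul] at h
  refine Eq.trans ?_ h.symm
  simp [snd]

end TensorSquare

section Coinvariants

open Coalgebra

variable {k : Type} [CommRing k]
variable {H A P : Type} [Ring H] [Algebra k H] [Ring A] [Algebra k A] [AddCommGroup P] [Module k P]
variable [Coalgebra k H] [IsCocomm k H]
variable {W : HopfData k H} {φ : H ⊗[k] A →ₗ[k] A} {σ σinv : H ⊗[k] H →ₗ[k] A}
  {p : A ⊗[k] H →ₗ[k] P} {ι : P →ₗ[k] A ⊗[k] H}

theorem crossMul_PiL_left (hW : IsWeakHopf W) (hcc : Cocomm W) (hδ : W.δ = comul)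
    (hcs : IsCrossedSystem W φ σ σinv)
    (hsplit : ι ∘ₗ p = nabla W φ) (hretr : p ∘ₗ ι = LinearMap.id) (x y : H) :
    crossMul W φ σ p ι ((p ∘ₗ TensorProduct.mk k A H 1) (PiL W x) ⊗ₜ[k]
        (p ∘ₗ TensorProduct.mk k A H 1) y) =
      (p ∘ₗ TensorProduct.mk k A H 1) (PiL W x * y) := by
  have hγ : IsPoint W (PiL W ∘ₗ fst k H) := by
    refine LinearMap.ext fun c => ?_
    rw [LinearMap.comp_apply, LinearMap.comp_apply, δ_PiL hW hcc, hδ,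
      ← LinearMap.comp_apply comul, comul_fst, map_pair]
  have hβ : IsPoint W (snd k H) := by rw [IsPoint, hδ, comul_snd]
  have h := LinearMap.congr_fun (crossMul_base_left hW hcc hcs hsplit hretr (isBase_PiL hW hcc)
    hγ hβ) (x ⊗ₜ[k] y)
  rw [LinearMap.comp_apply, ← map_pair, LinearMap.comp_apply, conv_comul_apply, ← rTensor_pair,
    pair_fst_snd_tmul] at h
  exact h

theorem zetaGen_base (hW : IsWeakHopf W) (hcc : Cocomm W) (hδ : W.δ = comul)
    (hcs : IsCrossedSystem W φ σ σinv)
    (hsplit : ι ∘ₗ p = nabla W φ) (hretr : p ∘ₗ ι = LinearMap.id) {x : H} (hx : IsBase W x) :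
    zetaGen (crossMul W φ σ p ι)
        (LinearMap.rTensor H (p ∘ₗ TensorProduct.mk k A H 1) (W.δ 1))
        ((p ∘ₗ TensorProduct.mk k A H 1) x) =
      LinearMap.rTensor H (p ∘ₗ TensorProduct.mk k A H 1) (W.δ x) := by
  have key : ∀ t : H ⊗[k] H, zetaGen (crossMul W φ σ p ι)
        (LinearMap.rTensor H (p ∘ₗ TensorProduct.mk k A H 1) (LinearMap.rTensor H (PiL W) t))
        ((p ∘ₗ TensorProduct.mk k A H 1) x) =
      LinearMap.rTensor H (p ∘ₗ TensorProduct.mk k A H 1)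
        (LinearMap.rTensor H (PiL W) t * (x ⊗ₜ[k] (1 : H))) := fun t => by
    induction t using TensorProduct.induction_on with
    | zero => simp [zetaGen]
    | tmul y z =>
      rw [LinearMap.rTensor_tmul, LinearMap.rTensor_tmul, zetaGen,
        TensorProduct.tensorTensorTensorComm_tmul, TensorProduct.map_tmul,
        crossMul_PiL_left hW hcc hδ hcs hsplit hretr, Algebra.TensorProduct.tmul_mul_tmul,
        LinearMap.rTensor_tmul, LinearMap.mul'_apply]
    | add t s ht hs =>
      simp only [zetaGen] at ht hs ⊢
      simp only [map_add, add_mul, add_tmul, ht, hs]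
  have h := key (W.δ 1)
  rw [rTensor_PiL_δ_one hW hcc, ← hx.2] at h
  exact h

end Coinvariants

/-- The coalgebra underlying a weak Hopf algebra. -/
abbrev IsWeakHopf.toCoalgebra {k H : Type} [CommRing k] [Ring H] [Algebra k H] {W : HopfData k H}
    (hW : IsWeakHopf W) : Coalgebra k H where
  comul := W.δ
  counit := W.ε
  coassoc := LinearMap.ext hW.coassoc
  rTensor_counit_comp_comul := LinearMap.ext fun h =>
    (TensorProduct.lid k H).injective <| by simpa using hW.counit_left h
  lTensor_counit_comp_comul := LinearMap.ext fun h =>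
    (TensorProduct.rid k H).injective <| by simpa using hW.counit_right h

/-- Let `H` be a cocommutative weak Hopf algebra and
`(φ, σ)` a crossed system for `H` over `A`.  Then `A ↪ A×_σH` is an `H`-cleft
extension: `f = p∘(η_A⊗H)` is a convolution invertible total integral with
convolution inverse `f⁻¹ = p∘(σ⁻¹⊗H)∘(H⊗c_{H,H})∘((δ_H∘λ_H)⊗H)∘δ_H`, and
`f ∧ f⁻¹` takes values in the coinvariants of `A×_σH`. -/
theorem statement11 {k H A P : Type} [CommRing k] [Ring H] [Algebra k H]
    [Ring A] [Algebra k A] [AddCommGroup P] [Module k P]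
    (W : HopfData k H) (hW : IsWeakHopf W) (hcc : Cocomm W)
    (φ : H ⊗[k] A →ₗ[k] A) (σ σinv : H ⊗[k] H →ₗ[k] A)
    (hcs : IsCrossedSystem W φ σ σinv)
    (p : A ⊗[k] H →ₗ[k] P) (ι : P →ₗ[k] A ⊗[k] H)
    (hsplit : ι ∘ₗ p = nabla W φ) (hretr : p ∘ₗ ι = LinearMap.id) :
    -- notation: `m` the product, `e` the unit, `ρP` the coaction of `A×_σH`,
    -- `f` the integral and `finv` its prospective convolution inverse
    ∀ m e ρP f finv, m = crossMul W φ σ p ι → e = crossUnit W φ p →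
      ρP = crossCoact W p ι →
      f = p ∘ₗ TensorProduct.mk k A H 1 →
      finv = p ∘ₗ LinearMap.rTensor H σinv
        ∘ₗ (TensorProduct.assoc k H H H).symm.toLinearMap
        ∘ₗ LinearMap.lTensor H (TensorProduct.comm k H H).toLinearMap
        ∘ₗ (TensorProduct.assoc k H H H).toLinearMap
        ∘ₗ LinearMap.rTensor H (W.δ ∘ₗ W.lam)
        ∘ₗ W.δ →
      -- `f` is a total integral:
      (∀ h : H, ρP (f h) = (LinearMap.rTensor H f) (W.δ h)) ∧
      f (1 : H) = e ∧
      -- `finv` is the convolution inverse of `f`: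
      convG k W.δ m finv f = eGen W (ρP e) ∧
      convG k W.δ m f finv = dGen W (ρP e) ∧
      convG k W.δ m (convG k W.δ m finv f) finv = finv ∧
      -- `f ∧ f⁻¹` takes values in the coinvariants:
      (∀ h : H, ρP (convG k W.δ m f finv h) =
        zetaGen m (ρP e) (convG k W.δ m f finv h)) := by
  let := hW.toCoalgebra
  have hδ : W.δ = Coalgebra.comul := rfl
  have hε : W.ε = Coalgebra.counit := rfl
  have : Coalgebra.IsCocomm k H := ⟨LinearMap.ext hcc⟩
  rintro m e ρP f finv rfl rfl rfl rfl hfinv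
  have hid : W.δ = pair LinearMap.id LinearMap.id := isPoint_id hδ
  have hlam := isPoint_lam hW hcc hδ
  have hfinv' : finv = p ∘ₗ pair (σinv ∘ₗ pair W.lam LinearMap.id) W.lam := by
    rw [hfinv, hlam]
    conv_lhs => rw [hid]
    rw [rTensor_comp_pair, LinearMap.comp_id, assoc_comp_pair, lTensor_comp_pair, comm_comp_pair,
      assoc_symm_comp_pair, rTensor_comp_pair]
  have hρ := crossCoact_integral (W := W) hδ hsplit hretr
  have hunit : (p ∘ₗ TensorProduct.mk k A H 1) 1 = crossUnit W φ p := by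
    rw [crossUnit, ← hsplit]
    exact (LinearMap.congr_fun hretr _).symm
  have hL := integral_conv_inv hW hcc hδ hε hcs hsplit hretr
  have hR := inv_conv_integral hW hcc hδ hcs hsplit hretr
  rw [hfinv', hL, hR, ← hunit, hρ 1, eGen_rTensor, dGen_rTensor]
  refine ⟨hρ, rfl, rfl, congrArg _ (PiL_eq_dGen hcc), base_conv_inv hW hcc hδ hcs hsplit hretr,
    fun h => ?_⟩
  rw [LinearMap.comp_apply, hρ]
  exact (zetaGen_base hW hcc hδ hcs hsplit hretr (isBase_PiL hW hcc h)).symm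

end WHA

end
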